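/- In a minimal counterexample (G, S, R, v, P_k(v), Q, k) to the Extension Theorem, the set V(G) − S − R is an independent set, i.e., there is no edge of G with both endpoints in V(G) − S − R. -/

import Mathlib

/-!
Multigraphs are modelled by a vertex type `V`, an edge type `E`, and an
incidence map `ends : E → Sym2 V` giving the (unordered) pair of endpoints
of each edge.  Subgraphs are identified with their edge sets (`Set E`).
-/

namespace SteinerPacking

variable {V E : Type}

/-- The set of edges incident to a vertex `u` (denoted `E(u)` in the paper). -/
def incEdges (ends : E → Sym2 V) (u : V) : Set E := {e | u ∈ ends e}

/-- The degree `d(u) = |E(u)|` of a vertex. -/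
noncomputable def deg (ends : E → Sym2 V) (u : V) : ℕ := (incEdges ends u).ncard

/-- One step along an edge of the edge set `F`. -/
def Step (ends : E → Sym2 V) (F : Set E) (a b : V) : Prop := ∃ e ∈ F, ends e = s(a, b)

/-- `a` and `b` are joined by a walk using only edges in `F`. -/
def Reaches (ends : E → Sym2 V) (F : Set E) (a b : V) : Prop :=
  Relation.ReflTransGen (Step ends F) a b

/-- The vertex set `S` is connected in the subgraph with edge set `F`. -/
def ConnectsSet (ends : E → Sym2 V) (F : Set E) (S : Set V) : Prop :=
  ∀ a ∈ S, ∀ b ∈ S, Reaches ends F a b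

/-- A walk from `u` to `w` given by a list of edges. -/
inductive IsWalk (ends : E → Sym2 V) : V → V → List E → Prop
  | nil (v : V) : IsWalk ends v v []
  | cons {u v w : V} {e : E} {l : List E} :
      ends e = s(u, v) → IsWalk ends v w l → IsWalk ends u w (e :: l)

/-- A path from `u` to `v` using edges of `F` (a walk with no repeated edges). -/
def IsPathIn (ends : E → Sym2 V) (F : Set E) (u v : V) (l : List E) : Prop :=
  IsWalk ends u v l ∧ l.Nodup ∧ ∀ e ∈ l, e ∈ F

/-- There are `n` pairwise edge-disjoint paths from `u` to `v` inside `F`. -/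
def EdgeDisjointPathsIn (ends : E → Sym2 V) (F : Set E) (n : ℕ) (u v : V) : Prop :=
  ∃ P : Fin n → List E, (∀ i, IsPathIn ends F u v (P i)) ∧
    ∀ i j, i ≠ j → ∀ e ∈ P i, e ∉ P j

/-- `S` is `n`-edge-connected in the (sub)graph with edge set `F`:
any two distinct vertices of `S` are joined by `n` edge-disjoint paths. -/
def EdgeConnectedIn (ends : E → Sym2 V) (F : Set E) (S : Set V) (n : ℕ) : Prop :=
  ∀ a ∈ S, ∀ b ∈ S, a ≠ b → EdgeDisjointPathsIn ends F n a b

/-- A family of subgraphs (edge sets) is pairwise edge-disjoint. -/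
def PairwiseEdgeDisjoint {k : ℕ} (H : Fin k → Set E) : Prop :=
  ∀ i j, i ≠ j → Disjoint (H i) (H j)

/-- `v` is a cut vertex of the subgraph with edge set `H`: some two vertices
distinct from `v` are connected in `H` but not after removing `v`. -/
def IsCutVertexOf (ends : E → Sym2 V) (H : Set E) (v : V) : Prop :=
  ∃ a b : V, a ≠ v ∧ b ≠ v ∧ Reaches ends H a b ∧
    ¬ Reaches ends {e ∈ H | v ∉ ends e} a b

/-- A subpartition of `E(v)` into `k` (possibly empty) parts. -/
def IsSubpartitionAt {k : ℕ} (ends : E → Sym2 V) (v : V) (P : Fin k → Set E) : Prop :=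
  (∀ i, P i ⊆ incEdges ends v) ∧ ∀ i j, i ≠ j → Disjoint (P i) (P j)

/-- A balanced partition of `E(v)` into `k` parts: each part has ≥ 2 edges. -/
def IsBalancedPartitionAt {k : ℕ} (ends : E → Sym2 V) (v : V) (P : Fin k → Set E) : Prop :=
  IsSubpartitionAt ends v P ∧ (⋃ i, P i) = incEdges ends v ∧ ∀ i, 2 ≤ (P i).ncard

/-- A balanced subpartition of `E(v)`: one extendable to a balanced partition. -/
def IsBalancedSubpartitionAt {k : ℕ} (ends : E → Sym2 V) (v : V) (P : Fin k → Set E) : Prop :=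
  IsSubpartitionAt ends v P ∧
    ∃ P' : Fin k → Set E, IsBalancedPartitionAt ends v P' ∧ ∀ i, P i ⊆ P' i

/-- The subgraphs `H 1, …, H k` extend the subpartition `P` at `v`:
`P i ⊆ H i` and `v` is not a cut vertex of any `H i`. -/
def Extend {k : ℕ} (ends : E → Sym2 V) (v : V) (P H : Fin k → Set E) : Prop :=
  ∀ i, P i ⊆ H i ∧ ¬ IsCutVertexOf ends (H i) v

/-- The subgraphs `H 1, …, H k` balance the vertex `u`. -/
def BalanceVertex {k : ℕ} (ends : E → Sym2 V) (H : Fin k → Set E) (u : V) : Prop :=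
  IsBalancedSubpartitionAt ends u (fun i => incEdges ends u ∩ H i)

/-- The subgraphs `H 1, …, H k` balance every vertex of `T`. -/
def BalanceSet {k : ℕ} (ends : E → Sym2 V) (H : Fin k → Set E) (T : Set V) : Prop :=
  ∀ u ∈ T, BalanceVertex ends H u

/-- A loopless multigraph. -/
def Loopless (ends : E → Sym2 V) : Prop := ∀ e : E, ¬ (ends e).IsDiag

/-- The set of neighbors of a vertex. -/
def neighbors (ends : E → Sym2 V) (u : V) : Set V := {w | ∃ e, ends e = s(u, w)}

/-- There is no family of `k` pairwise edge-disjoint `S`-subgraphs that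
balance `S ∪ R` and extend the subpartition `P` at `v`. -/
def NoGoodPacking {k : ℕ} (ends : E → Sym2 V) (S R : Set V) (v : V)
    (P : Fin k → Set E) : Prop :=
  ¬ ∃ H : Fin k → Set E, PairwiseEdgeDisjoint H ∧ (∀ i, ConnectsSet ends (H i) S) ∧
      BalanceSet ends H (S ∪ R) ∧ Extend ends v P H

/-- `(G, S, R, v, P, Q, k)` is a counterexample to the Extension Theorem:
it satisfies all hypotheses of the Extension Theorem (including that every
label appears at least twice at `v`), yet admits no good packing. -/
def ExtCex (Q k : ℕ) (ends : E → Sym2 V) (S R : Set V) (v : V)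
    (P : Fin k → Set E) : Prop :=
  36 ≤ Q ∧ 0 < k ∧ Disjoint S R ∧ 2 ≤ S.ncard ∧
  EdgeConnectedIn ends Set.univ S (Q * k) ∧
  (∀ r ∈ R, (Q - 2) * k ≤ deg ends r) ∧
  v ∈ S ∧ (∀ e : E, v ∈ ends e → ¬ (ends e).IsDiag) ∧
  deg ends v = Q * k ∧
  IsBalancedSubpartitionAt ends v P ∧ (∀ i, 2 ≤ (P i).ncard) ∧
  NoGoodPacking ends S R v P

/-- The measure used for minimality: number of vertices plus number of
non-loop edges. -/
noncomputable def extMeasure (ends : E → Sym2 V) : ℕ :=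
  Nat.card V + {e : E | ¬ (ends e).IsDiag}.ncard

/-- A minimal counterexample to the Extension Theorem: a counterexample whose
measure is at most the measure of every counterexample (with the same `Q`, `k`). -/
def MinExtCex (Q k : ℕ) (ends : E → Sym2 V) (S R : Set V) (v : V)
    (P : Fin k → Set E) : Prop :=
  ExtCex Q k ends S R v P ∧
  ∀ (V' E' : Type) (_ : Finite V') (_ : Finite E') (ends' : E' → Sym2 V')
    (S' R' : Set V') (v' : V') (P' : Fin k → Set E'),
    ExtCex Q k ends' S' R' v' P' → extMeasure ends ≤ extMeasure ends'

section Cuts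

variable [Fintype E]

open Classical in
/-- The edges with exactly one endpoint in `X`, where the edge `e` joins `a e` and `b e`. -/
noncomputable def cut (a b : E → V) (X : Set V) : Finset E :=
  Finset.univ.filter fun e => ¬ (a e ∈ X ↔ b e ∈ X)

theorem mem_cut {a b : E → V} {X : Set V} {e : E} :
    e ∈ cut a b X ↔ ¬ (a e ∈ X ↔ b e ∈ X) := by
  simp [cut]

theorem mem_cut_singleton {a b : E → V} {u : V} {e : E} :
    e ∈ cut a b {u} ↔ ¬ (a e = u ↔ b e = u) := by
  simp [mem_cut]

theorem cut_compl (a b : E → V) (X : Set V) : cut a b Xᶜ = cut a b X := by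
  ext e; simp only [mem_cut, Set.mem_compl_iff]; tauto

theorem cut_comp (a b : E → V) (f : V → V) (X : Set V) :
    cut (f ∘ a) (f ∘ b) X = cut a b (f ⁻¹' X) := by
  ext e; simp [mem_cut]

theorem cut_empty (a b : E → V) : cut a b ∅ = ∅ := by
  ext e; simp [mem_cut]

open Classical in
theorem card_cut (a b : E → V) (X : Set V) :
    (cut a b X).card = ∑ e, if e ∈ cut a b X then 1 else 0 := by
  simp

/-- `X` separates two elements of `S`. -/
def Separates (S X : Set V) : Prop := (∃ s ∈ S, s ∈ X) ∧ ∃ s ∈ S, s ∉ X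

theorem Separates.compl {S X : Set V} (h : Separates S X) : Separates S Xᶜ := by
  obtain ⟨⟨s, hs, hx⟩, t, ht, hy⟩ := h
  exact ⟨⟨t, ht, hy⟩, s, hs, fun h => h hx⟩

/-- A cut version of the hypotheses of the Extension Theorem. Loops are ignored, and `D u` is an
upper bound for the number of edges available for balancing at `u`. -/
structure ExtData {k : ℕ} (Q : ℕ) (a b : E → V) (S : Set V) (v : V) (D : V → ℕ)
    (P : E → Fin k) : Prop where
  mem : v ∈ S
  other : ∃ s ∈ S, s ≠ v
  conn : ∀ X, Separates S X → Q * k ≤ (cut a b X).card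
  card_cut_v : (cut a b {v}).card = Q * k
  le_D : ∀ u, (cut a b {u}).card ≤ D u
  D_large : ∀ u, (cut a b {u}).card + 2 * k ≤ D u ∨ (Q - 2) * k ≤ D u
  twice : ∀ i, 2 ≤ ((cut a b {v}).filter (P · = i)).card

/-- The terminals of the colour class `i` in the graph without `v`: the elements of `S` and the
neighbours of `v` along edges of colour `i`. -/
def Terminal {k : ℕ} (a b : E → V) (S : Set V) (v : V) (c : E → Option (Fin k)) (i : Fin k)
    (x : V) : Prop :=
  x ≠ v ∧ (x ∈ S ∨ ∃ e, c e = some i ∧ (a e = v ∧ b e = x ∨ a e = x ∧ b e = v))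

/-- A cut version of the conclusion of the Extension Theorem. -/
structure GoodColoring {k : ℕ} (a b : E → V) (S : Set V) (v : V) (D : V → ℕ)
    (P : E → Fin k) (c : E → Option (Fin k)) : Prop where
  ext : ∀ e ∈ cut a b {v}, c e = some (P e)
  conn : ∀ i Y, v ∉ Y → (∀ e, c e = some i → e ∉ cut a b {v} → e ∉ cut a b Y) →
    (∀ x, Terminal a b S v c i x → x ∈ Y) ∨ (∀ x, Terminal a b S v c i x → x ∉ Y)
  bal : ∀ u, ∑ i, max 2 ((cut a b {u}).filter (c · = some i)).card ≤ D u

theorem exists_map_fiber_card_ge {E : Type} {k : ℕ} (hk : 0 < k) (B : Finset E) (need : Fin k → ℕ)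
    (h : ∑ i, need i ≤ B.card) :
    ∃ g : E → Fin k, ∀ i, need i ≤ (B.filter (g · = i)).card := by
  classical
  have hc : Fintype.card (Σ i, Fin (need i)) ≤ Fintype.card B := by
    simpa using h
  obtain ⟨f⟩ := Function.Embedding.nonempty_of_card_le hc
  refine ⟨fun e => if hx : ∃ x, (f x : E) = e then hx.choose.1 else ⟨0, hk⟩, fun i => ?_⟩
  have : (Finset.univ.image fun j : Fin (need i) => (f ⟨i, j⟩ : E)).card = need i := by
    rw [Finset.card_image_of_injective]
    · simp
    · intro x y hxy
      have := f.injective (Subtype.ext hxy)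
      simpa using this
  rw [← this]
  refine Finset.card_le_card fun e he => ?_
  obtain ⟨j, -, rfl⟩ := Finset.mem_image.1 he
  have hx : ∃ x, (f x : E) = f ⟨i, j⟩ := ⟨_, rfl⟩
  refine Finset.mem_filter.2 ⟨(f ⟨i, j⟩).2, ?_⟩
  simp only
  rw [dif_pos hx, f.injective (Subtype.ext hx.choose_spec)]

/-- A partial colouring in which the missing edges can be supplied by uncoloured edges extends to
a colouring using each colour twice. -/
theorem exists_balanced_completion {E : Type} {k : ℕ} (hk : 0 < k) (A : Finset E)
    (c : E → Option (Fin k))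
    (h : ∑ i, max 2 (A.filter (c · = some i)).card ≤ A.card) :
    ∃ P : E → Fin k, (∀ e ∈ A, ∀ i, c e = some i → P e = i) ∧
      ∀ i, 2 ≤ (A.filter (P · = i)).card := by
  classical
  have hsplit : A.card = (A.filter (c · = none)).card +
      ∑ i, (A.filter (c · = some i)).card := by
    rw [Finset.card_eq_sum_card_fiberwise (f := c) (t := Finset.univ) (fun _ _ => by simp)]
    rw [Fintype.sum_option]
  obtain ⟨g, hg⟩ := exists_map_fiber_card_ge hk (A.filter (c · = none))
    (fun i => 2 - (A.filter (c · = some i)).card) (by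
      have : ∑ i, max 2 (A.filter (c · = some i)).card = ∑ i, (2 - (A.filter (c · = some i)).card)
          + ∑ i, (A.filter (c · = some i)).card := by
        rw [← Finset.sum_add_distrib]
        exact Finset.sum_congr rfl fun i _ => by omega
      omega)
  refine ⟨fun e => (c e).getD (g e), fun e _ i hi => by simp [hi], fun i => ?_⟩
  have h1 : (A.filter (c · = none)).filter (g · = i) ∪ A.filter (c · = some i) ⊆
      A.filter fun e => (c e).getD (g e) = i := by
    intro e he
    simp only [Finset.mem_union, Finset.mem_filter] at he ⊢
    rcases he with ⟨⟨h1, h2⟩, h3⟩ | ⟨h1, h2⟩ <;> simp [*]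
  have h2 := Finset.card_le_card h1
  rw [Finset.card_union_of_disjoint] at h2
  · have := hg i
    beta_reduce
    omega
  · rw [Finset.disjoint_left]
    intro e he he'
    simp only [Finset.mem_filter] at he he'
    simp [he.1.2] at he'

end Cuts

section Reductions

variable [Fintype E]

/-- Every choice of data on the multigraph given by `a` and `b` has a good colouring. -/
def Extendable (Q k : ℕ) (a b : E → V) : Prop :=
  ∀ (S : Set V) (v : V) (D : V → ℕ) (P : E → Fin k),
    ExtData Q a b S v D P → ∃ c, GoodColoring a b S v D P c

variable {Q k : ℕ} {a b : E → V} {S : Set V} {v : V} {D : V → ℕ} {P : E → Fin k}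

theorem ExtData.separates_v (h : ExtData Q a b S v D P) : Separates S {v} :=
  ⟨⟨v, h.mem, rfl⟩, h.other⟩

theorem Separates.preimage {f : V → V} {Y : Set V} (h : Separates (f '' S) Y) :
    Separates S (f ⁻¹' Y) := by
  obtain ⟨⟨_, ⟨s, hs, rfl⟩, hx⟩, _, ⟨t, ht, rfl⟩, hy⟩ := h
  exact ⟨⟨s, hs, hx⟩, t, ht, hy⟩

open Classical in
theorem cut_update {e₀ : E} (X : Set V) :
    cut a (Function.update b e₀ (a e₀)) X = (cut a b X).erase e₀ := by
  ext e
  by_cases he : e = e₀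
  · subst he; simp [mem_cut]
  · simp [mem_cut, he]

/-- An edge in no tight cut can be deleted, that is, turned into a loop. -/
theorem ExtData.exists_coloring_of_delete (h : ExtData Q a b S v D P) (e₀ : E)
    (he : ∀ X, Separates S X → (cut a b X).card = Q * k → e₀ ∉ cut a b X)
    (ih : Extendable Q k a (open Classical in Function.update b e₀ (a e₀))) :
    ∃ c, GoodColoring a b S v D P c := by
  classical
  have hv : cut a (Function.update b e₀ (a e₀)) {v} = cut a b {v} := by
    rw [cut_update, Finset.erase_eq_of_notMem (he _ h.separates_v h.card_cut_v)]
  have hle : ∀ u, (cut a (Function.update b e₀ (a e₀)) {u}).card ≤ (cut a b {u}).card :=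
    fun u => by rw [cut_update]; exact Finset.card_erase_le
  obtain ⟨c, hc⟩ := ih S v D P
    { mem := h.mem
      other := h.other
      conn := fun X hX => by
        rw [cut_update]
        by_cases hx : e₀ ∈ cut a b X
        · have h1 := h.conn X hX
          have h2 : (cut a b X).card ≠ Q * k := fun h' => he X hX h' hx
          rw [Finset.card_erase_of_mem hx]
          omega
        · rw [Finset.erase_eq_of_notMem hx]
          exact h.conn X hX
      card_cut_v := by rw [hv, h.card_cut_v]
      le_D := fun u => (hle u).trans (h.le_D u)
      D_large := fun u => (h.D_large u).imp (fun h' => by have := hle u; omega) id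
      twice := fun i => by rw [hv]; exact h.twice i }
  have key : ∀ e i, Function.update c e₀ none e = some i → e ≠ e₀ ∧ c e = some i := by
    intro e i hi
    by_cases h' : e = e₀
    · subst h'; simp at hi
    · exact ⟨h', by simpa [h'] using hi⟩
  refine ⟨Function.update c e₀ none, fun e hev => ?_, fun i Y hY hcr => ?_, fun u => ?_⟩
  · have : e ≠ e₀ := fun h' => he _ h.separates_v h.card_cut_v (h' ▸ hev)
    rw [Function.update_of_ne this]
    exact hc.ext e (by rwa [hv])
  · have h1 := hc.conn i Y hY fun e hei hev => by
      rw [hv] at hev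
      rw [cut_update, Finset.mem_erase]
      rintro ⟨h1, h2⟩
      exact hcr e (by simp [h1, hei]) hev h2
    have h2 : ∀ x, Terminal a b S v (Function.update c e₀ none) i x →
        Terminal a (Function.update b e₀ (a e₀)) S v c i x := by
      rintro x ⟨hx, hx'⟩
      refine ⟨hx, hx'.imp id ?_⟩
      rintro ⟨e, hei, h'⟩
      obtain ⟨h1, h2⟩ := key e i hei
      exact ⟨e, h2, by simpa [h1] using h'⟩
    exact h1.imp (fun h' x hx => h' x (h2 x hx)) (fun h' x hx => h' x (h2 x hx))
  · refine le_trans (Finset.sum_le_sum fun i _ => max_le_max le_rfl ?_) (hc.bal u)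
    refine Finset.card_le_card fun e he' => ?_
    rw [Finset.mem_filter] at he' ⊢
    obtain ⟨h1, h2⟩ := key e i he'.2
    exact ⟨by rw [cut_update]; exact Finset.mem_erase.2 ⟨h1, he'.1⟩, h2⟩

open Classical in
theorem ExtData.exists_coloring_of_tight_aux (hk : 0 < k) (h : ExtData Q a b S v D P) (X : Set V)
    (hv : v ∉ X) (hX : Separates S X) (ht : (cut a b X).card = Q * k)
    (ih : ∀ f : V → V, (∃ e, a e ≠ b e ∧ f (a e) = f (b e)) → Extendable Q k (f ∘ a) (f ∘ b))
    (he : ∃ e, a e ≠ b e ∧ a e ∈ X ∧ b e ∈ X) (he' : ∃ e, a e ≠ b e ∧ a e ∉ X ∧ b e ∉ X) :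
    ∃ c, GoodColoring a b S v D P c := by
  have hQ : (Q - 2) * k ≤ Q * k := Nat.mul_le_mul_right _ (Nat.sub_le _ _)
  obtain ⟨x₀, hx₀S, hx₀⟩ := hX.1
  have hxv : x₀ ≠ v := fun h' => hv (h' ▸ hx₀)
  set f₁ : V → V := fun u => if u ∈ X then x₀ else u with hf₁
  set f₂ : V → V := fun u => if u ∈ X then u else v with hf₂
  have f₁in : ∀ u, u ∈ X → f₁ u = x₀ := fun u hu => if_pos hu
  have f₁out : ∀ u, u ∉ X → f₁ u = u := fun u hu => if_neg hu
  have f₂in : ∀ u, u ∈ X → f₂ u = u := fun u hu => if_pos hu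
  have f₂out : ∀ u, u ∉ X → f₂ u = v := fun u hu => if_neg hu
  have pre₁ : ∀ u, u ∉ X → f₁ ⁻¹' {u} = {u} := by
    intro u hu; ext w
    by_cases hw : w ∈ X
    · have h1 : x₀ ≠ u := fun h' => hu (h' ▸ hx₀)
      have h2 : w ≠ u := fun h' => hu (h' ▸ hw)
      simp [f₁in w hw, h1, h2]
    · simp [f₁out w hw]
  have pre₁x : f₁ ⁻¹' {x₀} = X := by
    ext w
    by_cases hw : w ∈ X
    · simp [f₁in w hw, hw]
    · have h2 : w ≠ x₀ := fun h' => hw (h' ▸ hx₀)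
      simp [f₁out w hw, h2, hw]
  have pre₁e : ∀ u ∈ X, u ≠ x₀ → f₁ ⁻¹' {u} = ∅ := by
    intro u hu hux; ext w
    by_cases hw : w ∈ X
    · simp [f₁in w hw, hux.symm]
    · have h2 : w ≠ u := fun h' => hw (h' ▸ hu)
      simp [f₁out w hw, h2]
  have pre₂ : ∀ u ∈ X, f₂ ⁻¹' {u} = {u} := by
    intro u hu; ext w
    by_cases hw : w ∈ X
    · simp [f₂in w hw]
    · have h1 : v ≠ u := fun h' => hv (h' ▸ hu)
      have h2 : w ≠ u := fun h' => hw (h' ▸ hu)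
      simp [f₂out w hw, h1, h2]
  have pre₂v : f₂ ⁻¹' {v} = Xᶜ := by
    ext w
    by_cases hw : w ∈ X
    · have h2 : w ≠ v := fun h' => hv (h' ▸ hw)
      simp [f₂in w hw, hw, h2]
    · simp [f₂out w hw, hw]
  have pre₂e : ∀ u, u ∉ X → u ≠ v → f₂ ⁻¹' {u} = ∅ := by
    intro u hu huv; ext w
    by_cases hw : w ∈ X
    · have h2 : w ≠ u := fun h' => hu (h' ▸ hw)
      simp [f₂in w hw, h2]
    · simp [f₂out w hw, huv.symm]
  obtain ⟨c₁, hc₁⟩ := ih f₁ (by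
      obtain ⟨e, h1, h2, h3⟩ := he
      exact ⟨e, h1, by rw [f₁in _ h2, f₁in _ h3]⟩) (f₁ '' S) v
      (fun u => if u ∈ X then Q * k else D u) P
    { mem := ⟨v, h.mem, f₁out v hv⟩
      other := ⟨x₀, ⟨x₀, hx₀S, f₁in _ hx₀⟩, hxv⟩
      conn := fun Y hY => by rw [cut_comp]; exact h.conn _ hY.preimage
      card_cut_v := by rw [cut_comp, pre₁ v hv, h.card_cut_v]
      le_D := fun u => by
        rw [cut_comp]
        by_cases hu : u ∈ X
        · rw [if_pos hu]
          by_cases hux : u = x₀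
          · rw [hux, pre₁x, ht]
          · rw [pre₁e u hu hux, cut_empty]; simp
        · rw [if_neg hu, pre₁ u hu]; exact h.le_D u
      D_large := fun u => by
        rw [cut_comp]
        by_cases hu : u ∈ X
        · rw [if_pos hu]; exact Or.inr hQ
        · rw [if_neg hu, pre₁ u hu]; exact h.D_large u
      twice := fun i => by rw [cut_comp, pre₁ v hv]; exact h.twice i }
  have hb := hc₁.bal x₀
  rw [cut_comp, pre₁x, if_pos hx₀, ← ht] at hb
  obtain ⟨P₂, hP₂, hP₂t⟩ := exists_balanced_completion hk _ _ hb
  obtain ⟨c₂, hc₂⟩ := ih f₂ (by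
      obtain ⟨e, h1, h2, h3⟩ := he'
      exact ⟨e, h1, by rw [f₂out _ h2, f₂out _ h3]⟩) (f₂ '' S) v
      (fun u => if u ∈ X then D u else Q * k) P₂
    { mem := ⟨v, h.mem, f₂out v hv⟩
      other := ⟨x₀, ⟨x₀, hx₀S, f₂in _ hx₀⟩, hxv⟩
      conn := fun Y hY => by rw [cut_comp]; exact h.conn _ hY.preimage
      card_cut_v := by rw [cut_comp, pre₂v, cut_compl, ht]
      le_D := fun u => by
        rw [cut_comp]
        by_cases hu : u ∈ X
        · rw [if_pos hu, pre₂ u hu]; exact h.le_D u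
        · rw [if_neg hu]
          by_cases huv : u = v
          · rw [huv, pre₂v, cut_compl, ht]
          · rw [pre₂e u hu huv, cut_empty]; simp
      D_large := fun u => by
        rw [cut_comp]
        by_cases hu : u ∈ X
        · rw [if_pos hu, pre₂ u hu]; exact h.D_large u
        · rw [if_neg hu]; exact Or.inr hQ
      twice := fun i => by rw [cut_comp, pre₂v, cut_compl]; exact hP₂t i }
  have hv₁ : cut (f₁ ∘ a) (f₁ ∘ b) {v} = cut a b {v} := by rw [cut_comp, pre₁ v hv]
  have hv₂ : cut (f₂ ∘ a) (f₂ ∘ b) {v} = cut a b X := by rw [cut_comp, pre₂v, cut_compl]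
  have h12 : ∀ e ∈ cut a b X, ∀ i, c₁ e = some i → c₂ e = some i := by
    intro e hex i hi
    rw [hc₂.ext e (by rwa [hv₂]), hP₂ e hex i hi]
  set c : E → Option (Fin k) := fun e => if a e ∈ X ∧ b e ∈ X then c₂ e else c₁ e with hc
  have cin : ∀ e, a e ∈ X → b e ∈ X → c e = c₂ e := fun e h1 h2 => if_pos ⟨h1, h2⟩
  have cout : ∀ e, ¬ (a e ∈ X ∧ b e ∈ X) → c e = c₁ e := fun e h1 => if_neg h1
  have ter₂ : ∀ i x, x ∈ X → Terminal a b S v c i x →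
      Terminal (f₂ ∘ a) (f₂ ∘ b) (f₂ '' S) v c₂ i x := by
    rintro i x hx ⟨hxv, hx'⟩
    refine ⟨hxv, ?_⟩
    rcases hx' with hxS | ⟨e, hei, hj⟩
    · exact Or.inl ⟨x, hxS, f₂in _ hx⟩
    · refine Or.inr ⟨e, h12 e ?_ i ?_, ?_⟩
      · rw [mem_cut]
        rcases hj with ⟨h1, h2⟩ | ⟨h1, h2⟩ <;> simp [h1, h2, hx, hv]
      · rw [cout e (by rcases hj with ⟨h1, h2⟩ | ⟨h1, h2⟩ <;> simp [h1, h2, hv])] at hei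
        exact hei
      · rcases hj with ⟨h1, h2⟩ | ⟨h1, h2⟩
        · exact Or.inl ⟨by simp [h1, f₂out v hv], by simp [h2, f₂in x hx]⟩
        · exact Or.inr ⟨by simp [h1, f₂in x hx], by simp [h2, f₂out v hv]⟩
  have ter₁ : ∀ i x, x ∉ X → Terminal a b S v c i x →
      Terminal (f₁ ∘ a) (f₁ ∘ b) (f₁ '' S) v c₁ i x := by
    rintro i x hx ⟨hxv, hx'⟩
    refine ⟨hxv, ?_⟩
    rcases hx' with hxS | ⟨e, hei, hj⟩
    · exact Or.inl ⟨x, hxS, f₁out _ hx⟩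
    · refine Or.inr ⟨e, ?_, ?_⟩
      · rwa [cout e (by rcases hj with ⟨h1, h2⟩ | ⟨h1, h2⟩ <;> simp [h1, h2, hv])] at hei
      · rcases hj with ⟨h1, h2⟩ | ⟨h1, h2⟩
        · exact Or.inl ⟨by simp [h1, f₁out v hv], by simp [h2, f₁out x hx]⟩
        · exact Or.inr ⟨by simp [h1, f₁out x hx], by simp [h2, f₁out v hv]⟩
  have terx : ∀ i, Terminal (f₁ ∘ a) (f₁ ∘ b) (f₁ '' S) v c₁ i x₀ := fun i =>
    ⟨hxv, Or.inl ⟨x₀, hx₀S, f₁in _ hx₀⟩⟩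
  have tera : ∀ i e, c₁ e = some i → a e ∈ X → b e ∉ X →
      Terminal (f₂ ∘ a) (f₂ ∘ b) (f₂ '' S) v c₂ i (a e) := fun i e hi h1 h2 =>
    ⟨fun h' => hv (h' ▸ h1), Or.inr ⟨e, h12 e (by simp [mem_cut, h1, h2]) i hi,
      Or.inr ⟨by simp [f₂in _ h1], by simp [f₂out _ h2]⟩⟩⟩
  have terb : ∀ i e, c₁ e = some i → a e ∉ X → b e ∈ X →
      Terminal (f₂ ∘ a) (f₂ ∘ b) (f₂ '' S) v c₂ i (b e) := fun i e hi h1 h2 =>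
    ⟨fun h' => hv (h' ▸ h2), Or.inr ⟨e, h12 e (by simp [mem_cut, h1, h2]) i hi,
      Or.inl ⟨by simp [f₂out _ h1], by simp [f₂in _ h2]⟩⟩⟩
  refine ⟨c, fun e hev => ?_, fun i Y hY hcr => ?_, fun u => ?_⟩
  · rw [cout e, hc₁.ext e (by rwa [hv₁])]
    rintro ⟨h1, h2⟩
    rw [mem_cut_singleton] at hev
    have h3 : a e ≠ v := fun h' => hv (h' ▸ h1)
    have h4 : b e ≠ v := fun h' => hv (h' ▸ h2)
    tauto
  · have key := hc₂.conn i (Y ∩ X) (fun h' => hY h'.1) fun e hei hev => by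
      rw [hv₂, mem_cut, not_not] at hev
      rw [cut_comp, mem_cut, not_not]
      by_cases h1 : a e ∈ X
      · have h2 := hev.1 h1
        have h3 := hcr e (by rw [cin e h1 h2, hei]) (by
          have h3 : a e ≠ v := fun h' => hv (h' ▸ h1)
          have h4 : b e ≠ v := fun h' => hv (h' ▸ h2)
          simp [mem_cut_singleton, h3, h4])
        rw [mem_cut, not_not] at h3
        simp [f₂in _ h1, f₂in _ h2, h1, h2, h3]
      · have h2 := fun h' => h1 (hev.2 h')
        simp [f₂out _ h1, f₂out _ h2]
    rcases key with key | key
    · refine Or.inl ?_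
      have key₁ := hc₁.conn i (Y ∪ X) (by simp [hY, hv]) fun e hei hev => by
        rw [hv₁] at hev
        rw [cut_comp, mem_cut, not_not]
        by_cases h1 : a e ∈ X <;> by_cases h2 : b e ∈ X
        · simp [f₁in _ h1, f₁in _ h2]
        · have h3 := hcr e (by rw [cout e (by tauto), hei]) hev
          have h4 := (key _ (tera i e hei h1 h2)).1
          rw [mem_cut, not_not] at h3
          simp [f₁in _ h1, f₁out _ h2, hx₀, h3.1 h4]
        · have h3 := hcr e (by rw [cout e (by tauto), hei]) hev
          have h4 := (key _ (terb i e hei h1 h2)).1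
          rw [mem_cut, not_not] at h3
          simp [f₁out _ h1, f₁in _ h2, hx₀, h3.2 h4]
        · have h3 := hcr e (by rw [cout e (by tauto), hei]) hev
          rw [mem_cut, not_not] at h3
          simp [f₁out _ h1, f₁out _ h2, h1, h2, h3]
      replace key₁ := key₁.resolve_right fun h' => h' _ (terx i) (Or.inr hx₀)
      intro x hx
      by_cases hxX : x ∈ X
      · exact (key _ (ter₂ i x hxX hx)).1
      · exact (key₁ _ (ter₁ i x hxX hx)).resolve_right hxX
    · refine Or.inr ?_
      have key₁ := hc₁.conn i (Y \ X) (by simp [hY]) fun e hei hev => by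
        rw [hv₁] at hev
        rw [cut_comp, mem_cut, not_not]
        by_cases h1 : a e ∈ X <;> by_cases h2 : b e ∈ X
        · simp [f₁in _ h1, f₁in _ h2]
        · have h3 := hcr e (by rw [cout e (by tauto), hei]) hev
          have h4 : a e ∉ Y := fun h' => key _ (tera i e hei h1 h2) ⟨h', h1⟩
          rw [mem_cut, not_not] at h3
          simp [f₁in _ h1, f₁out _ h2, hx₀, mt h3.2 h4]
        · have h3 := hcr e (by rw [cout e (by tauto), hei]) hev
          have h4 : b e ∉ Y := fun h' => key _ (terb i e hei h1 h2) ⟨h', h2⟩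
          rw [mem_cut, not_not] at h3
          simp [f₁out _ h1, f₁in _ h2, hx₀, mt h3.1 h4]
        · have h3 := hcr e (by rw [cout e (by tauto), hei]) hev
          rw [mem_cut, not_not] at h3
          simp [f₁out _ h1, f₁out _ h2, h1, h2, h3]
      replace key₁ := key₁.resolve_left fun h' => (h' _ (terx i)).2 hx₀
      intro x hx hxY
      by_cases hxX : x ∈ X
      · exact key _ (ter₂ i x hxX hx) ⟨hxY, hxX⟩
      · exact key₁ _ (ter₁ i x hxX hx) ⟨hxY, hxX⟩
  · by_cases hu : u ∈ X
    · have h1 := hc₂.bal u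
      rw [if_pos hu, cut_comp, pre₂ u hu] at h1
      refine le_trans (Finset.sum_le_sum fun i _ => max_le_max le_rfl ?_) h1
      refine Finset.card_le_card fun e he' => ?_
      rw [Finset.mem_filter] at he' ⊢
      refine ⟨he'.1, ?_⟩
      by_cases h2 : a e ∈ X ∧ b e ∈ X
      · rw [← cin e h2.1 h2.2, he'.2]
      · refine h12 e ?_ i (by rw [← cout e h2, he'.2])
        have h3 := he'.1
        rw [mem_cut_singleton] at h3
        rw [mem_cut]
        intro h4
        by_cases h5 : a e = u
        · exact h2 ⟨h5 ▸ hu, h4.1 (h5 ▸ hu)⟩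
        · have h6 : b e = u := by tauto
          exact h2 ⟨h4.2 (h6 ▸ hu), h6 ▸ hu⟩
    · have h1 := hc₁.bal u
      rw [if_neg hu, cut_comp, pre₁ u hu] at h1
      refine le_trans (Finset.sum_le_sum fun i _ => max_le_max le_rfl ?_) h1
      refine Finset.card_le_card fun e he' => ?_
      rw [Finset.mem_filter] at he' ⊢
      refine ⟨he'.1, ?_⟩
      rw [← cout e, he'.2]
      rintro ⟨h1, h2⟩
      have h3 := he'.1
      rw [mem_cut_singleton] at h3
      have h4 : a e ≠ u := fun h' => hu (h' ▸ h1)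
      have h5 : b e ≠ u := fun h' => hu (h' ▸ h2)
      tauto

/-- A tight cut with edges on both sides can be split into two contractions. -/
theorem ExtData.exists_coloring_of_tight (hk : 0 < k) (h : ExtData Q a b S v D P) (X : Set V)
    (hX : Separates S X) (ht : (cut a b X).card = Q * k)
    (ih : ∀ f : V → V, (∃ e, a e ≠ b e ∧ f (a e) = f (b e)) → Extendable Q k (f ∘ a) (f ∘ b))
    (he : ∃ e, a e ≠ b e ∧ a e ∈ X ∧ b e ∈ X) (he' : ∃ e, a e ≠ b e ∧ a e ∉ X ∧ b e ∉ X) :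
    ∃ c, GoodColoring a b S v D P c := by
  by_cases hv : v ∈ X
  · refine h.exists_coloring_of_tight_aux hk Xᶜ (fun h' => h' hv) hX.compl
      (by rw [cut_compl, ht]) ih he' ?_
    obtain ⟨e, h1, h2, h3⟩ := he
    exact ⟨e, h1, fun h' => h' h2, fun h' => h' h3⟩
  · exact h.exists_coloring_of_tight_aux hk X hv hX ht ih he he'

end Reductions

section Splitting

/-- The combinatorial core of edge splitting: dangerous neighbourhoods cannot cover all pairs. -/
theorem false_of_pairs_covered {α : Type} [DecidableEq α] (N : Finset α) (F : Set (Finset α))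
    (hN : 4 ≤ N.card) (hsub : ∀ X ∈ F, X ⊆ N)
    (hpair : ∀ e ∈ N, ∀ f ∈ N, e ≠ f → ∃ X ∈ F, e ∈ X ∧ f ∈ X)
    (hcard : ∀ X ∈ F, 2 * X.card ≤ N.card + 1)
    (hinter : ∀ X ∈ F, ∀ Y ∈ F, ∀ e f g, e ∈ X → e ∈ Y → f ∈ X → f ∉ Y → g ∈ Y → g ∉ X →
      ∀ e', e' ∈ X → e' ∈ Y → e' = e)
    (hthree : ∀ X ∈ F, ∀ Y ∈ F, ∀ Z ∈ F, ∀ e f g h, e ∈ X → e ∈ Y → e ∈ Z →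
      f ∈ X → f ∉ Y → f ∉ Z → g ∈ Y → g ∉ X → g ∉ Z → h ∈ Z → h ∉ X → h ∉ Y → False) :
    False := by
  have hfin : F.Finite := (N.powerset.finite_toSet).subset fun X hX => by simpa using hsub X hX
  have hmax : ∀ e ∈ N, ∀ f ∈ N, e ≠ f → ∃ X, Maximal (· ∈ F) X ∧ e ∈ X ∧ f ∈ X := by
    intro e he f hf hef
    obtain ⟨X, hX, h1, h2⟩ := hpair e he f hf hef
    obtain ⟨Y, hXY, hY⟩ := hfin.exists_le_maximal hX
    exact ⟨Y, hY, hXY h1, hXY h2⟩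
  have hmeet : ∀ X, Maximal (· ∈ F) X → ∀ Y ∈ F, ∀ e g, e ∈ X → e ∈ Y → g ∈ Y → g ∉ X →
      ∀ e', e' ∈ X → e' ∈ Y → e' = e := by
    intro X hX Y hY e g h1 h2 h3 h4
    have h5 : ¬ X ⊆ Y := fun h' => h4 (hX.le_of_ge hY h' h3)
    obtain ⟨f, hf, hf'⟩ := Finset.not_subset.1 h5
    exact hinter X hX.prop Y hY e f g h1 h2 hf hf' h3 h4
  obtain ⟨e, he, f, hf, hef⟩ := Finset.one_lt_card.1 (show 1 < N.card by omega)
  obtain ⟨X, hX, heX, hfX⟩ := hmax e he f hf hef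
  have hXc := hcard X hX.prop
  obtain ⟨g, hg, hgX⟩ := Finset.exists_mem_notMem_of_card_lt_card (show X.card < N.card by omega)
  have heg : e ≠ g := fun h' => hgX (h' ▸ heX)
  obtain ⟨Y, hY, heY, hgY⟩ := hmax e he g hg heg
  have hYc := hcard Y hY.prop
  have hXY := hmeet X hX Y hY.prop e g heX heY hgY hgX
  have hfY : f ∉ Y := fun h' => hef (hXY f hfX h').symm
  have hcov : N ⊆ X ∪ Y := by
    intro h hh
    by_contra hn
    simp only [Finset.mem_union, not_or] at hn
    obtain ⟨Z, hZ, heZ, hhZ⟩ := hmax e he h hh (fun h' => hn.1 (h' ▸ heX))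
    have h1 := hmeet X hX Z hZ.prop e h heX heZ hhZ hn.1
    have h2 := hmeet Y hY Z hZ.prop e h heY heZ hhZ hn.2
    exact hthree X hX.prop Y hY.prop Z hZ.prop e f g h heX heY heZ hfX hfY
      (fun h' => hef (h1 f hfX h').symm) hgY hgX (fun h' => heg (h2 g hgY h').symm) hhZ hn.1 hn.2
  have hXYc : 0 < (X ∩ Y).card := Finset.card_pos.2 ⟨e, Finset.mem_inter.2 ⟨heX, heY⟩⟩
  have h1 := Finset.card_le_card hcov
  have h2 := Finset.card_union_add_card_inter X Y
  have h3 : 2 < X.card := by omega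
  obtain ⟨f', hf', hf'n⟩ : ∃ f' ∈ X, f' ∉ ({e, f} : Finset α) :=
    Finset.exists_mem_notMem_of_card_lt_card (lt_of_le_of_lt Finset.card_le_two h3)
  simp only [Finset.mem_insert, Finset.mem_singleton, not_or] at hf'n
  have hf'Y : f' ∉ Y := fun h' => hf'n.1 (hXY f' hf' h')
  obtain ⟨Z, hZ, hfZ, hgZ⟩ := hmax f hf g hg (fun h' => hgX (h' ▸ hfX))
  obtain ⟨W, hW, hfW, hgW⟩ := hmax f' (hsub X hX.prop hf') g hg (fun h' => hgX (h' ▸ hf'))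
  have hZX := hmeet X hX Z hZ.prop f g hfX hfZ hgZ hgX
  have hWX := hmeet X hX W hW.prop f' g hf' hfW hgW hgX
  exact hthree Z hZ.prop W hW.prop Y hY.prop g f f' e hgZ hgW hgY hfZ
    (fun h' => hf'n.2 (hWX f hfX h').symm) hfY hfW (fun h' => hf'n.2 (hZX f' hf' h')) hf'Y heY
    (fun h' => hef (hZX e heX h')) (fun h' => hf'n.1 (hWX e heX h').symm)

variable [Fintype E]

open Classical in
/-- The end of the edge `e` other than `t`. -/
noncomputable def otherEnd (a b : E → V) (t : V) (e : E) : V := if a e = t then b e else a e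

variable {a b : E → V} {t : V}

theorem mem_cut_iff_otherEnd {e : E} (he : e ∈ cut a b {t}) {X : Set V} :
    e ∈ cut a b X ↔ ¬ (t ∈ X ↔ otherEnd a b t e ∈ X) := by
  rw [mem_cut_singleton] at he
  rw [mem_cut, otherEnd]
  by_cases h : a e = t
  · rw [if_pos h, h]
  · have h' : b e = t := by tauto
    rw [if_neg h, h']; tauto

theorem otherEnd_ne {e : E} (he : e ∈ cut a b {t}) : otherEnd a b t e ≠ t := by
  have := (mem_cut_iff_otherEnd he).1 he
  simpa using this

theorem otherEnd_cases {e : E} (he : e ∈ cut a b {t}) :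
    a e = t ∧ b e = otherEnd a b t e ∨ a e = otherEnd a b t e ∧ b e = t := by
  rw [mem_cut_singleton] at he
  rw [otherEnd]
  by_cases h : a e = t
  · simp [h]
  · have h' : b e = t := by tauto
    simp [h, h']

open Classical in
theorem card_filter_cut (X : Set V) (p : E → Prop) [DecidablePred p] :
    ((cut a b X).filter p).card = ∑ e, if e ∈ cut a b X ∧ p e then 1 else 0 := by
  rw [Finset.card_filter, ← Finset.sum_filter, ← Finset.sum_filter]
  exact Finset.sum_congr (by ext; simp) fun _ _ => rfl

open Classical in
theorem card_cut_insert (X : Set V) (ht : t ∉ X) :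
    (cut a b (insert t X)).card + 2 * ((cut a b {t}).filter (otherEnd a b t · ∈ X)).card =
      (cut a b X).card + (cut a b {t}).card := by
  simp only [card_filter_cut, card_cut, Finset.mul_sum, ← Finset.sum_add_distrib]
  refine Finset.sum_congr rfl fun e _ => ?_
  by_cases he : e ∈ cut a b {t}
  · have hne := otherEnd_ne he
    simp only [mem_cut_iff_otherEnd he, Set.mem_insert_iff, hne, ht, Set.mem_singleton_iff]
    by_cases h : otherEnd a b t e ∈ X <;> simp [h]
  · have h1 : a e = t ↔ b e = t := by simpa [mem_cut_singleton] using he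
    have h2 : e ∈ cut a b (insert t X) ↔ e ∈ cut a b X := by
      simp only [mem_cut, Set.mem_insert_iff]
      by_cases h : a e = t
      · have h' := h1.1 h
        simp [h, h']
      · have h' := mt h1.2 h
        simp [h, h']
    simp [he, h2]

open Classical in
theorem card_cut_sdiff (X Y : Set V) (hX : t ∉ X) (hY : t ∉ Y) :
    (cut a b (X \ Y)).card + (cut a b (Y \ X)).card +
      2 * ((cut a b {t}).filter fun e => otherEnd a b t e ∈ X ∧ otherEnd a b t e ∈ Y).card ≤
      (cut a b X).card + (cut a b Y).card := by
  simp only [card_filter_cut, card_cut, Finset.mul_sum, ← Finset.sum_add_distrib]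
  refine Finset.sum_le_sum fun e _ => ?_
  by_cases he : e ∈ cut a b {t}
  · simp only [mem_cut_iff_otherEnd he, Set.mem_sdiff, hX, hY]
    by_cases h : otherEnd a b t e ∈ X <;> by_cases h' : otherEnd a b t e ∈ Y <;>
      simp [h, h', otherEnd_ne he]
  · simp only [he, mem_cut, Set.mem_sdiff]
    by_cases h1 : a e ∈ X <;> by_cases h2 : a e ∈ Y <;> by_cases h3 : b e ∈ X <;>
      by_cases h4 : b e ∈ Y <;> simp [h1, h2, h3, h4]

open Classical in
theorem card_cut_three (X Y Z : Set V) (hX : t ∉ X) (hY : t ∉ Y) (hZ : t ∉ Z) {e₀ : E}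
    (he₀ : e₀ ∈ cut a b {t}) (h : otherEnd a b t e₀ ∈ X ∩ Y ∩ Z) :
    (cut a b (X ∩ Y ∩ Z)).card + (cut a b ((X \ Y) \ Z)).card + (cut a b ((Y \ X) \ Z)).card +
      (cut a b ((Z \ X) \ Y)).card + 2 ≤
      (cut a b X).card + (cut a b Y).card + (cut a b Z).card := by
  have h2 : 2 = ∑ e : E, if e = e₀ then 2 else 0 := by simp
  rw [h2]
  simp only [card_cut, ← Finset.sum_add_distrib]
  refine Finset.sum_le_sum fun e _ => ?_
  by_cases he : e = e₀
  · subst he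
    simp only [mem_cut_iff_otherEnd he₀, Set.mem_sdiff, Set.mem_inter_iff, hX, hY, hZ, h.1.1, h.1.2,
      h.2]
    simp
  · simp only [he, mem_cut, Set.mem_sdiff, Set.mem_inter_iff]
    by_cases h1 : a e ∈ X <;> by_cases h2 : a e ∈ Y <;> by_cases h3 : a e ∈ Z <;>
      by_cases h4 : b e ∈ X <;> by_cases h5 : b e ∈ Y <;> by_cases h6 : b e ∈ Z <;>
      simp [h1, h2, h3, h4, h5, h6]

/-- Mader's splitting theorem, in the case where all neighbours of `t` are terminals. -/
theorem exists_splittable_pair {S : Set V} {l : ℕ} (hl : 2 ≤ l)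
    (hconn : ∀ X, Separates S X → l ≤ (cut a b X).card) (ht : t ∉ S)
    (hS : ∀ e ∈ cut a b {t}, otherEnd a b t e ∈ S) (hd : 4 ≤ (cut a b {t}).card) :
    ∃ e ∈ cut a b {t}, ∃ f ∈ cut a b {t}, e ≠ f ∧ ∀ X, Separates S X → t ∉ X →
      otherEnd a b t e ∈ X → otherEnd a b t f ∈ X → l + 2 ≤ (cut a b X).card := by
  classical
  by_contra hcon
  push Not at hcon
  let nb : Set V → Finset E := fun X => (cut a b {t}).filter (otherEnd a b t · ∈ X)
  have mem_nb : ∀ {X e}, e ∈ nb X ↔ e ∈ cut a b {t} ∧ otherEnd a b t e ∈ X := by simp [nb]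
  refine false_of_pairs_covered (cut a b {t})
    {A | ∃ X, Separates S X ∧ t ∉ X ∧ (cut a b X).card < l + 2 ∧ A = nb X} hd ?_ ?_ ?_ ?_ ?_
  · rintro _ ⟨X, -, -, -, rfl⟩
    exact Finset.filter_subset _ _
  · intro e he f hf hef
    obtain ⟨X, h1, h2, h3, h4, h5⟩ := hcon e he f hf hef
    exact ⟨_, ⟨X, h1, h2, h5, rfl⟩, mem_nb.2 ⟨he, h3⟩, mem_nb.2 ⟨hf, h4⟩⟩
  · rintro _ ⟨X, hX, htX, hXc, rfl⟩
    have h1 := card_cut_insert (a := a) (b := b) X htX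
    have h2 := hconn (insert t X) (by
      obtain ⟨⟨s, hs, hx⟩, s', hs', hx'⟩ := hX
      refine ⟨⟨s, hs, Or.inr hx⟩, s', hs', ?_⟩
      rintro (rfl | h)
      · exact ht hs'
      · exact hx' h)
    show 2 * (nb X).card ≤ _
    simp only [nb]
    omega
  · rintro _ ⟨X, hX, htX, hXc, rfl⟩ _ ⟨Y, hY, htY, hYc, rfl⟩ e f g heX heY hfX
      hfY hgY hgX e' heX' heY'
    rw [mem_nb] at *
    have h1 := card_cut_sdiff (a := a) (b := b) X Y htX htY
    have h2 := hconn (X \ Y) ⟨⟨_, hS f hfX.1, hfX.2, fun h => hfY ⟨hfX.1, h⟩⟩, _, hS e heX.1,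
      fun h => h.2 heY.2⟩
    have h3 := hconn (Y \ X) ⟨⟨_, hS g hgY.1, hgY.2, fun h => hgX ⟨hgY.1, h⟩⟩, _, hS e heX.1,
      fun h => h.2 heX.2⟩
    have h4 : ((cut a b {t}).filter fun e =>
      otherEnd a b t e ∈ X ∧ otherEnd a b t e ∈ Y).card ≤ 1 := by omega
    exact Finset.card_le_one.1 h4 _ (Finset.mem_filter.2 ⟨heX'.1, heX'.2, heY'.2⟩) _
      (Finset.mem_filter.2 ⟨heX.1, heX.2, heY.2⟩)
  · rintro _ ⟨X, hX, htX, hXc, rfl⟩ _ ⟨Y, hY, htY, hYc, rfl⟩ _ ⟨Z, hZ, htZ, hZc, rfl⟩ e f g h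
      heX heY heZ hfX hfY hfZ hgY hgX hgZ hhZ hhX hhY
    rw [mem_nb] at *
    have h1 := card_cut_three (a := a) (b := b) X Y Z htX htY htZ heX.1 ⟨⟨heX.2, heY.2⟩, heZ.2⟩
    have h2 := hconn ((X \ Y) \ Z) ⟨⟨_, hS f hfX.1, ⟨hfX.2, fun h => hfY ⟨hfX.1, h⟩⟩,
      fun h => hfZ ⟨hfX.1, h⟩⟩, _, hS e heX.1, fun h => h.2 heZ.2⟩
    have h3 := hconn ((Y \ X) \ Z) ⟨⟨_, hS g hgY.1, ⟨hgY.2, fun h => hgX ⟨hgY.1, h⟩⟩,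
      fun h => hgZ ⟨hgY.1, h⟩⟩, _, hS e heX.1, fun h => h.2 heZ.2⟩
    have h4 := hconn ((Z \ X) \ Y) ⟨⟨_, hS h hhZ.1, ⟨hhZ.2, fun h' => hhX ⟨hhZ.1, h'⟩⟩,
      fun h' => hhY ⟨hhZ.1, h'⟩⟩, _, hS e heX.1, fun h => h.2 heY.2⟩
    have h5 := hconn (X ∩ Y ∩ Z) ⟨⟨_, hS e heX.1, ⟨heX.2, heY.2⟩, heZ.2⟩, _, hS f hfX.1,
      fun h => hfY ⟨hfX.1, h.1.2⟩⟩
    omega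

end Splitting

section SplitReduction

variable [Fintype E] {Q k : ℕ} {a b : E → V} {S : Set V} {v t : V} {D : V → ℕ}
  {P : E → Fin k}

open Classical in
/-- The edges that are not loops. -/
noncomputable def nonloop (a b : E → V) : Finset E := Finset.univ.filter fun e => a e ≠ b e

theorem mem_nonloop {e : E} : e ∈ nonloop a b ↔ a e ≠ b e := by simp [nonloop]

theorem ExtData.exists_coloring_of_split (h : ExtData Q a b S v D P) (ht : t ∉ S)
    (hS : ∀ e ∈ cut a b {t}, otherEnd a b t e ∈ S) (hl : 2 ≤ Q * k)
    (hD : (cut a b {t}).card + 2 * k ≤ D t) (hd : 4 ≤ (cut a b {t}).card)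
    (ih : ∀ a' b' : E → V, (nonloop a' b').card < (nonloop a b).card → Extendable Q k a' b') :
    ∃ c, GoodColoring a b S v D P c := by
  classical
  have htv : t ≠ v := fun h' => ht (h' ▸ h.mem)
  obtain ⟨e, he, f, hf, hef, hsplit, hyv⟩ : ∃ e ∈ cut a b {t}, ∃ f ∈ cut a b {t}, e ≠ f ∧
      (∀ X, Separates S X → t ∉ X → otherEnd a b t e ∈ X → otherEnd a b t f ∈ X →
        Q * k + 2 ≤ (cut a b X).card) ∧ otherEnd a b t f ≠ v := by
    obtain ⟨e, he, f, hf, hef, hs⟩ := exists_splittable_pair hl h.conn ht hS hd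
    by_cases hfv : otherEnd a b t f = v
    · refine ⟨f, hf, e, he, hef.symm, fun X h1 h2 h3 h4 => hs X h1 h2 h4 h3, fun hev => ?_⟩
      have := hs {v} h.separates_v htv hev hfv
      rw [h.card_cut_v] at this
      omega
    · exact ⟨e, he, f, hf, hef, hs, hfv⟩
  set x := otherEnd a b t e with hx
  set y := otherEnd a b t f with hy
  have hxt : x ≠ t := otherEnd_ne he
  have hyt : y ≠ t := otherEnd_ne hf
  set a' := Function.update (Function.update a e x) f t with ha'
  set b' := Function.update (Function.update b e y) f t with hb'
  have ae : a' e = x := by simp [a', hef]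
  have be : b' e = y := by simp [b', hef]
  have af : a' f = t := by simp [a']
  have bf : b' f = t := by simp [b']
  have ao : ∀ g, g ≠ e → g ≠ f → a' g = a g := fun g h1 h2 => by simp [a', h1, h2]
  have bo : ∀ g, g ≠ e → g ≠ f → b' g = b g := fun g h1 h2 => by simp [b', h1, h2]
  have ce : ∀ X, e ∈ cut a b X ↔ ¬ (t ∈ X ↔ x ∈ X) := fun X => mem_cut_iff_otherEnd he
  have cf : ∀ X, f ∈ cut a b X ↔ ¬ (t ∈ X ↔ y ∈ X) := fun X => mem_cut_iff_otherEnd hf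
  have ce' : ∀ X, e ∈ cut a' b' X ↔ ¬ (x ∈ X ↔ y ∈ X) := fun X => by rw [mem_cut, ae, be]
  have cf' : ∀ X, f ∉ cut a' b' X := fun X => by rw [mem_cut, af, bf]; simp
  have co : ∀ X g, g ≠ e → g ≠ f → (g ∈ cut a' b' X ↔ g ∈ cut a b X) := fun X g h1 h2 => by
    rw [mem_cut, mem_cut, ao g h1 h2, bo g h1 h2]
  have hconn_aux : ∀ X, Separates S X → t ∉ X → Q * k ≤ (cut a' b' X).card := by
    intro X hX htX
    have h0 := h.conn X hX
    by_cases h1 : x ∈ X <;> by_cases h2 : y ∈ X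
    · have h3 := hsplit X hX htX h1 h2
      have h4 : ((cut a b X).erase e).erase f ⊆ cut a' b' X := fun g hg => by
        simp only [Finset.mem_erase] at hg
        exact (co X g hg.2.1 hg.1).2 hg.2.2
      have h5 := Finset.card_le_card h4
      have h6 := Finset.pred_card_le_card_erase (s := cut a b X) (a := e)
      have h7 := Finset.pred_card_le_card_erase (s := (cut a b X).erase e) (a := f)
      omega
    · refine h0.trans (Finset.card_le_card fun g hg => ?_)
      by_cases hge : g = e
      · rw [hge, ce']; tauto
      · have hgf : g ≠ f := by rintro rfl; rw [cf] at hg; tauto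
        exact (co X g hge hgf).2 hg
    · have hfX : f ∈ cut a b X := by rw [cf]; tauto
      have h4 : insert e ((cut a b X).erase f) ⊆ cut a' b' X := fun g hg => by
        simp only [Finset.mem_insert, Finset.mem_erase] at hg
        by_cases hge : g = e
        · rw [hge, ce']; tauto
        · have := hg.resolve_left hge
          exact (co X g hge this.1).2 this.2
      have h5 := Finset.card_le_card h4
      rw [Finset.card_insert_of_notMem (by
        rw [Finset.mem_erase, ce]; tauto), Finset.card_erase_of_mem hfX] at h5
      omega
    · refine h0.trans (Finset.card_le_card fun g hg => ?_)
      have hge : g ≠ e := by rintro rfl; rw [ce] at hg; tauto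
      have hgf : g ≠ f := by rintro rfl; rw [cf] at hg; tauto
      exact (co X g hge hgf).2 hg
  have hconn : ∀ X, Separates S X → Q * k ≤ (cut a' b' X).card := by
    intro X hX
    by_cases htX : t ∈ X
    · rw [← cut_compl]
      exact hconn_aux _ hX.compl (fun h' => h' htX)
    · exact hconn_aux X hX htX
  have hv : cut a' b' {v} = cut a b {v} := by
    ext g
    by_cases hge : g = e
    · rw [hge, ce, ce']; simp [htv, hyv]
    · by_cases hgf : g = f
      · rw [hgf, cf]; simp [cf', htv, hyv]
      · exact co _ g hge hgf
  have hdeg : ∀ u, u ≠ t → (cut a' b' {u}).card ≤ (cut a b {u}).card := by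
    intro u hu
    by_cases hyu : y = u ∧ x ≠ u
    · have h1 : cut a' b' {u} ⊆ insert e ((cut a b {u}).erase f) := fun g hg => by
        by_cases hge : g = e
        · simp [hge]
        · have hgf : g ≠ f := by rintro rfl; exact cf' _ hg
          simp [hgf, (co _ g hge hgf).1 hg]
      have h2 : f ∈ cut a b {u} := by rw [cf]; simp [hyu.1, hu.symm]
      have h3 := (Finset.card_le_card h1).trans (Finset.card_insert_le _ _)
      have h4 := Finset.card_erase_add_one h2
      omega
    · refine Finset.card_le_card fun g hg => ?_
      have hgf : g ≠ f := by rintro rfl; exact cf' _ hg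
      by_cases hge : g = e
      · rw [hge, ce'] at hg
        rw [hge, ce]
        simp only [Set.mem_singleton_iff] at hg ⊢
        have := hu.symm
        tauto
      · exact (co _ g hge hgf).1 hg
  have hdt : (cut a' b' {t}).card + 2 ≤ (cut a b {t}).card := by
    have h1 : cut a' b' {t} ⊆ ((cut a b {t}).erase e).erase f := fun g hg => by
      have hgf : g ≠ f := by rintro rfl; exact cf' _ hg
      have hge : g ≠ e := by
        rintro rfl
        rw [ce'] at hg
        simp [hxt, hyt] at hg
      simp [hge, hgf, (co _ g hge hgf).1 hg]
    have h2 := Finset.card_le_card h1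
    rw [Finset.card_erase_of_mem (Finset.mem_erase.2 ⟨hef.symm, hf⟩),
      Finset.card_erase_of_mem he] at h2
    omega
  have hmeas : (nonloop a' b').card < (nonloop a b).card := by
    refine Finset.card_lt_card ⟨fun g hg => ?_, fun h' => ?_⟩
    · rw [mem_nonloop] at hg ⊢
      have hgf : g ≠ f := by rintro rfl; exact hg (af.trans bf.symm)
      by_cases hge : g = e
      · rw [hge]
        intro h'
        exact (mem_cut.1 he) (by rw [h'])
      · rwa [ao g hge hgf, bo g hge hgf] at hg
    · have h1 : f ∈ nonloop a b := by
        rw [mem_nonloop]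
        intro h'
        exact (mem_cut.1 hf) (by rw [h'])
      exact mem_nonloop.1 (h' h1) (af.trans bf.symm)
  obtain ⟨c', hc'⟩ := ih a' b' hmeas S v (Function.update D t (D t - 2)) P
    { mem := h.mem
      other := h.other
      conn := hconn
      card_cut_v := by rw [hv, h.card_cut_v]
      le_D := fun u => by
        by_cases hu : u = t
        · rw [hu, Function.update_self]; omega
        · rw [Function.update_of_ne hu]; exact (hdeg u hu).trans (h.le_D u)
      D_large := fun u => by
        by_cases hu : u = t
        · rw [hu, Function.update_self]; left; omega
        · rw [Function.update_of_ne hu]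
          have := hdeg u hu
          exact (h.D_large u).imp (fun h' => by omega) id
      twice := fun i => by rw [hv]; exact h.twice i }
  set c : E → Option (Fin k) := fun g =>
    if g = e ∨ g = f then (if x = y then none else c' e) else c' g with hc
  have cce : c e = if x = y then none else c' e := by simp [c]
  have ccf : c f = if x = y then none else c' e := by simp [c]
  have cco : ∀ g, g ≠ e → g ≠ f → c g = c' g := fun g h1 h2 => by simp [c, h1, h2]
  refine ⟨c, fun g hg => ?_, fun i Y hY hcr => ?_, fun u => ?_⟩
  · have hgf : g ≠ f := by rintro rfl; rw [← hv] at hg; exact cf' _ hg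
    rw [← hc'.ext g (by rwa [hv])]
    by_cases hge : g = e
    · subst hge
      rw [cce, if_neg]
      rintro h'
      rw [← hv, ce', h'] at hg
      simp at hg
    · exact cco g hge hgf
  · have hfv : f ∉ cut a b {v} := by rw [← hv]; exact cf' _
    have hfY : c f = some i → (t ∈ Y ↔ y ∈ Y) := fun h' => by
      have := hcr f h' hfv
      rwa [cf, not_not] at this
    have key := hc'.conn i Y hY fun g hgi hgv => by
      rw [hv] at hgv
      by_cases hgf : g = f
      · rw [hgf]; exact cf' _
      by_cases hge : g = e
      · subst hge
        rw [ce', not_not]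
        by_cases hxy : x = y
        · rw [hxy]
        · have h1 := hcr g (by rw [cce, if_neg hxy, hgi]) hgv
          rw [ce, not_not] at h1
          exact h1.symm.trans (hfY (by rw [ccf, if_neg hxy, hgi]))
      · rw [co _ _ hge hgf]
        exact hcr g (by rw [cco g hge hgf, hgi]) hgv
    have ter : ∀ z, Terminal a b S v c i z →
        ∃ z', Terminal a' b' S v c' i z' ∧ (z ∈ Y ↔ z' ∈ Y) := by
      rintro z ⟨hzv, hz⟩
      rcases hz with hzS | ⟨g, hgi, hj⟩
      · exact ⟨z, ⟨hzv, Or.inl hzS⟩, Iff.rfl⟩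
      · have hgv : g ∈ cut a b {v} := by
          rw [mem_cut_singleton]
          rcases hj with ⟨h1, h2⟩ | ⟨h1, h2⟩ <;> simp [h1, h2, hzv]
        have hgf : g ≠ f := by rintro rfl; exact hfv hgv
        by_cases hge : g = e
        · subst hge
          have hxy : x ≠ y := fun h' => by rw [cce, if_pos h'] at hgi; cases hgi
          have hxv : x = v := by
            rw [ce] at hgv
            simp only [Set.mem_singleton_iff] at hgv
            tauto
          have hzt : z = t := by
            rcases otherEnd_cases he with ⟨h1, h2⟩ | ⟨h1, h2⟩ <;>
              rcases hj with ⟨h3, h4⟩ | ⟨h3, h4⟩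
            · exact absurd (h1.symm.trans h3) htv
            · exact h3.symm.trans h1
            · exact h4.symm.trans h2
            · exact absurd (h2.symm.trans h4) htv
          rw [cce, if_neg hxy] at hgi
          refine ⟨y, ⟨hyv, Or.inr ⟨g, hgi, Or.inl ⟨ae.trans hxv, be⟩⟩⟩, ?_⟩
          rw [hzt]
          exact hfY (by rw [ccf, if_neg hxy, hgi])
        · refine ⟨z, ⟨hzv, Or.inr ⟨g, by rwa [cco g hge hgf] at hgi, ?_⟩⟩, Iff.rfl⟩
          rwa [ao g hge hgf, bo g hge hgf]
    refine key.imp (fun h' z hz => ?_) (fun h' z hz => ?_)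
    · obtain ⟨z', h1, h2⟩ := ter z hz
      exact h2.2 (h' z' h1)
    · obtain ⟨z', h1, h2⟩ := ter z hz
      exact fun h3 => h' z' h1 (h2.1 h3)
  · have hb := hc'.bal u
    by_cases hu : u = t
    · subst hu
      rw [Function.update_self] at hb
      have h1 : ∀ i, max 2 ((cut a b {u}).filter (c · = some i)).card ≤
          max 2 ((cut a' b' {u}).filter (c' · = some i)).card + if c e = some i then 2 else 0 := by
        intro i
        have h2 : ((cut a b {u}).filter (c · = some i)) ⊆
            (cut a' b' {u}).filter (c' · = some i) ∪ if c e = some i then {e, f} else ∅ := by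
          intro g hg
          rw [Finset.mem_filter] at hg
          rw [Finset.mem_union, Finset.mem_filter]
          by_cases hge : g = e
          · subst hge; right; rw [if_pos hg.2]; simp
          by_cases hgf : g = f
          · subst hgf; right; rw [if_pos (by rw [cce, ← ccf, hg.2])]; simp
          left
          exact ⟨(co _ g hge hgf).2 hg.1, by rw [← cco g hge hgf, hg.2]⟩
        have h3 := (Finset.card_le_card h2).trans (Finset.card_union_le _ _)
        split_ifs at h3 ⊢
        · rw [Finset.card_pair hef] at h3; omega
        · simp only [Finset.card_empty] at h3; omega
      have h2 : ∑ i, (if c e = some i then 2 else 0) ≤ 2 := by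
        cases hce : c e with
        | none => simp
        | some j => simp
      have h3 := Finset.sum_le_sum fun i (_ : i ∈ Finset.univ) => h1 i
      rw [Finset.sum_add_distrib] at h3
      omega
    · rw [Function.update_of_ne hu] at hb
      refine le_trans (Finset.sum_le_sum fun i _ => max_le_max le_rfl ?_) hb
      by_cases hyu : (y = u ∧ x ≠ u) ∧ c' e = some i
      · have h1 : (cut a b {u}).filter (c · = some i) ⊆
            insert f (((cut a' b' {u}).filter (c' · = some i)).erase e) := fun g hg => by
          rw [Finset.mem_filter] at hg
          by_cases hgf : g = f
          · simp [hgf]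
          · have hge : g ≠ e := by
              rintro rfl
              rw [ce] at hg
              simp [hyu.1.2, Ne.symm hu] at hg
            simp [hge, (co _ g hge hgf).2 hg.1, ← cco g hge hgf, hg.2]
        have h2 : e ∈ (cut a' b' {u}).filter (c' · = some i) := by
          rw [Finset.mem_filter, ce']
          simp [hyu.1.1, hyu.1.2, hyu.2]
        have h3 := (Finset.card_le_card h1).trans (Finset.card_insert_le _ _)
        have h4 := Finset.card_erase_add_one h2
        omega
      · refine Finset.card_le_card fun g hg => ?_
        rw [Finset.mem_filter] at hg ⊢
        have hgf : g ≠ f := by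
          rintro rfl
          rw [cf, ccf] at hg
          by_cases hxy : x = y
          · rw [if_pos hxy] at hg; cases hg.2
          · rw [if_neg hxy] at hg
            simp only [Set.mem_singleton_iff, Ne.symm hu, false_iff, not_not] at hg
            exact hyu ⟨⟨hg.1, fun h' => hxy (h'.trans hg.1.symm)⟩, hg.2⟩
        by_cases hge : g = e
        · subst hge
          rw [ce, cce] at hg
          by_cases hxy : x = y
          · rw [if_pos hxy] at hg; cases hg.2
          · rw [if_neg hxy] at hg
            simp only [Set.mem_singleton_iff, Ne.symm hu, false_iff, not_not] at hg
            rw [ce']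
            refine ⟨?_, hg.2⟩
            simp only [Set.mem_singleton_iff, hg.1, true_iff]
            exact fun h' => hxy (hg.1.trans h'.symm)
        · exact ⟨(co _ g hge hgf).2 hg.1, by rw [← cco g hge hgf, hg.2]⟩

end SplitReduction

section Packing

open Classical in
/-- A covering version of Rado's theorem: elements can be distributed among supermodular antitone
functions so as to make their values small. -/
theorem exists_distribution {ι J : Type} [Fintype ι] [Fintype J] [Nonempty J]
    (κ : J → Finset ι → ℕ) (hanti : ∀ j A B, A ⊆ B → κ j B ≤ κ j A)
    (hsup : ∀ j A B, κ j A + κ j B ≤ κ j (A ∪ B) + κ j (A ∩ B))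
    (h : ∀ I : Finset ι, ∑ j, κ j I ≤ Iᶜ.card + Fintype.card J) :
    ∃ φ : ι → J, ∑ j, κ j (Finset.univ.filter (φ · = j)) ≤ Fintype.card J := by
  suffices H : ∀ (n : ℕ) (A : ι → Finset J), ∑ t, (A t).card = n →
      (∀ I : Finset ι, ∑ j, κ j (I.filter (j ∈ A ·)) ≤ Iᶜ.card + Fintype.card J) →
      ∃ φ : ι → J, ∑ j, κ j (Finset.univ.filter (φ · = j)) ≤ Fintype.card J from
    H _ (fun _ => Finset.univ) rfl (by simpa using h)
  intro n
  induction n using Nat.strong_induction_on with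
  | _ n ih =>
    intro A hn hA
    by_cases hsmall : ∀ t, (A t).card ≤ 1
    · refine ⟨fun t => if ht : (A t).Nonempty then ht.choose else Classical.arbitrary J, ?_⟩
      have h1 := hA Finset.univ
      rw [Finset.compl_univ, Finset.card_empty, zero_add] at h1
      refine le_trans (Finset.sum_le_sum fun j _ => hanti j _ _ fun t ht => ?_) h1
      rw [Finset.mem_filter] at ht ⊢
      refine ⟨Finset.mem_univ _, ?_⟩
      have hne : (A t).Nonempty := ⟨j, ht.2⟩
      simp only
      rw [dif_pos hne]
      exact Finset.card_le_one.1 (hsmall t) _ hne.choose_spec _ ht.2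
    · push Not at hsmall
      obtain ⟨t, ht⟩ := hsmall
      obtain ⟨j₁, h₁, j₂, h₂, hne⟩ := Finset.one_lt_card.1 ht
      have hdec : ∀ j ∈ A t, ∑ s, (Function.update A t ((A t).erase j) s).card < n := by
        intro j hj
        rw [← hn]
        refine Finset.sum_lt_sum (fun s _ => ?_) ⟨t, Finset.mem_univ _, ?_⟩
        · by_cases hs : s = t
          · subst hs; simpa using Finset.card_le_card (Finset.erase_subset _ _)
          · simp [hs]
        · simpa using Finset.card_erase_lt_of_mem hj
      by_contra hcon
      have hbad : ∀ j ∈ A t, ∃ I : Finset ι, Iᶜ.card + Fintype.card J <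
          ∑ i, κ i (I.filter (i ∈ Function.update A t ((A t).erase j) ·)) := by
        intro j hj
        by_contra hgood
        push Not at hgood
        exact hcon (ih _ (hdec j hj) _ rfl hgood)
      obtain ⟨I₁, hI₁⟩ := hbad j₁ h₁
      obtain ⟨I₂, hI₂⟩ := hbad j₂ h₂
      have hmem : ∀ j ∈ A t, ∀ I : Finset ι, Iᶜ.card + Fintype.card J <
          ∑ i, κ i (I.filter (i ∈ Function.update A t ((A t).erase j) ·)) → t ∈ I := by
        intro j hj I hI
        by_contra htI
        have : ∀ i, I.filter (i ∈ Function.update A t ((A t).erase j) ·) =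
            I.filter (i ∈ A ·) := fun i => Finset.filter_congr fun s hs => by
          have hst : s ≠ t := fun h' => htI (h' ▸ hs)
          simp [hst]
        simp only [this] at hI
        exact absurd (hA I) (not_le.2 hI)
      have ht₁ := hmem _ h₁ _ hI₁
      have ht₂ := hmem _ h₂ _ hI₂
      have key : ∑ i, κ i (I₁.filter (i ∈ Function.update A t ((A t).erase j₁) ·)) +
          ∑ i, κ i (I₂.filter (i ∈ Function.update A t ((A t).erase j₂) ·)) ≤
          ∑ i, κ i ((I₁ ∪ I₂).filter (i ∈ A ·)) +
          ∑ i, κ i (((I₁ ∩ I₂).erase t).filter (i ∈ A ·)) := by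
        rw [← Finset.sum_add_distrib, ← Finset.sum_add_distrib]
        refine Finset.sum_le_sum fun i _ => (hsup i _ _).trans (add_le_add ?_ ?_)
        · refine hanti i _ _ fun s hs => ?_
          simp only [Finset.mem_filter, Finset.mem_union] at hs ⊢
          by_cases hst : s = t
          · subst hst
            simp only [Function.update_self, Finset.mem_erase, ht₁, ht₂, hs.2]
            by_cases hi : i = j₁
            · right; exact ⟨trivial, by rwa [hi], trivial⟩
            · left; exact ⟨trivial, hi, trivial⟩
          · simpa [hst, hs.2] using hs.1
        · refine hanti i _ _ fun s hs => ?_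
          simp only [Finset.mem_filter, Finset.mem_inter, Finset.mem_erase] at hs ⊢
          simp [hs.1.1, hs.1.2.1, hs.1.2.2, hs.2]
      have k1 := hA (I₁ ∪ I₂)
      have k2 := hA ((I₁ ∩ I₂).erase t)
      have c1 := Finset.card_union_add_card_inter I₁ I₂
      have c2 := Finset.card_erase_add_one (Finset.mem_inter.2 ⟨ht₁, ht₂⟩)
      have c3 := Finset.card_add_card_compl (I₁ ∪ I₂)
      have c4 := Finset.card_add_card_compl ((I₁ ∩ I₂).erase t)
      have c5 := Finset.card_add_card_compl I₁
      have c6 := Finset.card_add_card_compl I₂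
      omega

variable {W ι J : Type}

/-- The functions taking equal values at any two vertices related by an element of `A`. -/
def respecting (N : ι → W → W → Prop) (A : Finset ι) : Submodule ℚ (W → ℚ) where
  carrier := {f | ∀ t ∈ A, ∀ u w, N t u w → f u = f w}
  add_mem' := fun hf hg t ht u w h => by simp [hf t ht u w h, hg t ht u w h]
  zero_mem' := fun _ _ _ _ _ => rfl
  smul_mem' := fun r f hf t ht u w h => by simp [hf t ht u w h]

/-- The partition of the vertices not distinguished by the functions in a submodule. -/
def inseparable (K : Submodule ℚ (W → ℚ)) : Setoid W where
  r u w := ∀ f ∈ K, f u = f w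
  iseqv := ⟨fun _ _ _ => rfl, fun h f hf => (h f hf).symm,
    fun h h' f hf => (h f hf).trans (h' f hf)⟩

theorem finrank_le_card_quotient [Fintype W] (K : Submodule ℚ (W → ℚ)) :
    Module.finrank ℚ K ≤ Nat.card (Quotient (inseparable K)) := by
  classical
  have : K ≤ LinearMap.range (LinearMap.funLeft ℚ ℚ (Quotient.mk (inseparable K))) := by
    intro f hf
    exact ⟨Quotient.lift f fun u w huw => huw f hf, rfl⟩
  refine (Submodule.finrank_mono this).trans ((LinearMap.finrank_range_le _).trans ?_)
  rw [Module.finrank_fintype_fun_eq_card, Nat.card_eq_fintype_card]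

theorem finrank_range_funLeft_mk [Fintype W] (s : Setoid W) :
    Module.finrank ℚ (LinearMap.range (LinearMap.funLeft ℚ ℚ (Quotient.mk s))) =
      Nat.card (Quotient s) := by
  classical
  rw [LinearMap.finrank_range_of_inj
    (LinearMap.funLeft_injective_of_surjective _ _ _ Quotient.mk_surjective),
    Module.finrank_fintype_fun_eq_card, Nat.card_eq_fintype_card]

/-- A packing theorem: if every refinement of `s` is crossed by sufficiently many elements, then
the elements can be distributed among the colours so that each colour class connects every class
of `s`. -/
theorem exists_connecting_distribution [Fintype W] [Fintype ι] [Fintype J] [Nonempty J]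
    (N : ι → W → W → Prop) (s : Setoid W) (hs : ∀ t u w, N t u w → s u w)
    (h : ∀ r : Setoid W, r ≤ s → ∃ T : Finset ι,
      Fintype.card J * (Nat.card (Quotient r) - Nat.card (Quotient s)) ≤ T.card ∧
        ∀ t ∈ T, ∃ u w, N t u w ∧ ¬ r u w) :
    ∃ φ : ι → J, ∀ j (Y : Set W), (∀ t, φ t = j → ∀ u w, N t u w → (u ∈ Y ↔ w ∈ Y)) →
      ∀ u w, s u w → (u ∈ Y ↔ w ∈ Y) := by
  classical
  set L := LinearMap.range (LinearMap.funLeft ℚ ℚ (Quotient.mk s)) with hL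
  have hLK : ∀ A, L ≤ respecting N A := by
    rintro A _ ⟨f, rfl⟩ t _ u w huw
    exact congrArg f (Quotient.sound (hs t u w huw))
  have hq : ∀ A, Nat.card (Quotient s) ≤ Module.finrank ℚ (respecting N A) := fun A => by
    rw [← finrank_range_funLeft_mk]
    exact Submodule.finrank_mono (hLK A)
  obtain ⟨φ, hφ⟩ := exists_distribution (J := J)
    (fun _ A => Module.finrank ℚ (respecting N A) + 1 - Nat.card (Quotient s))
    (fun _ A B hAB => by
      have : Module.finrank ℚ (respecting N B) ≤ Module.finrank ℚ (respecting N A) :=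
        Submodule.finrank_mono fun f hf t ht => hf t (hAB ht)
      omega)
    (fun _ A B => by
      have h1 := Submodule.finrank_sup_add_finrank_inf_eq (respecting N A) (respecting N B)
      have h2 : Module.finrank ℚ ↥(respecting N A ⊔ respecting N B) ≤
          Module.finrank ℚ (respecting N (A ∩ B)) := by
        refine Submodule.finrank_mono (sup_le ?_ ?_)
        · exact fun f hf t ht => hf t (Finset.mem_inter.1 ht).1
        · exact fun f hf t ht => hf t (Finset.mem_inter.1 ht).2
      have h3 : Module.finrank ℚ ↥(respecting N A ⊓ respecting N B) ≤
          Module.finrank ℚ (respecting N (A ∪ B)) :=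
        Submodule.finrank_mono fun f hf t ht =>
          (Finset.mem_union.1 ht).elim (hf.1 t) (hf.2 t)
      have h4 := hq A
      have h5 := hq B
      have h6 := hq (A ∪ B)
      have h7 := hq (A ∩ B)
      omega)
    (fun I => by
      obtain ⟨T, h1, hT⟩ := h (inseparable (respecting N I)) (fun u w huw => by
        have := huw (LinearMap.funLeft ℚ ℚ (Quotient.mk s)
          (fun q => if q = Quotient.mk s u then 1 else 0)) (hLK I ⟨_, rfl⟩)
        by_contra hne
        have hne' : ¬ (Quotient.mk s w = Quotient.mk s u) := fun h' =>
          hne (Quotient.exact h'.symm)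
        simp [LinearMap.funLeft_apply, hne'] at this)
      have h3 : T.card ≤ Iᶜ.card := by
        refine Finset.card_le_card fun t ht => ?_
        obtain ⟨u, w, hN, huw⟩ := hT t ht
        rw [Finset.mem_compl]
        exact fun htI => huw fun f hf => hf t htI u w hN
      have h4 := finrank_le_card_quotient (respecting N I)
      have h5 := hq I
      rw [Finset.sum_const, Finset.card_univ, smul_eq_mul]
      have h6 : Module.finrank ℚ (respecting N I) + 1 - Nat.card (Quotient s) ≤
          Nat.card (Quotient (inseparable (respecting N I))) - Nat.card (Quotient s) + 1 := by
        omega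
      have h7 := Nat.mul_le_mul_left (Fintype.card J) h6
      rw [mul_add, mul_one] at h7
      omega)
  refine ⟨φ, fun j Y hY u w huw => ?_⟩
  have hle : Module.finrank ℚ (respecting N (Finset.univ.filter (φ · = j))) ≤
      Nat.card (Quotient s) := by
    by_contra hlt
    rw [not_le] at hlt
    have := Finset.sum_lt_sum (s := Finset.univ) (f := fun _ : J => 1)
      (g := fun i => Module.finrank ℚ (respecting N (Finset.univ.filter (φ · = i))) + 1 -
        Nat.card (Quotient s))
      (fun i _ => by have := hq (Finset.univ.filter (φ · = i)); omega)
      ⟨j, Finset.mem_univ _, by omega⟩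
    simp only [Finset.sum_const, Finset.card_univ, smul_eq_mul, mul_one] at this
    omega
  have heq : L = respecting N (Finset.univ.filter (φ · = j)) :=
    Submodule.eq_of_le_of_finrank_le (hLK _) (by rwa [hL, finrank_range_funLeft_mk])
  have hgm : (fun z => if z ∈ Y then 1 else 0 : W → ℚ) ∈ L := by
    rw [heq]
    intro t ht z z' hzz
    simp [hY t (Finset.mem_filter.1 ht).2 z z' hzz]
  obtain ⟨f, hf⟩ := hgm
  have h1 : ∀ z, f (Quotient.mk s z) = if z ∈ Y then 1 else 0 := fun z => congrFun hf z
  have h2 := h1 u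
  rw [Quotient.sound huw, h1 w] at h2
  by_cases hu : u ∈ Y <;> by_cases hw : w ∈ Y <;> simp [hu, hw] at h2 ⊢

end Packing

section Reduced

variable [Fintype E]

/-- The data remaining after all reductions: edges meet `S`, and vertices outside `S` have either
small or large degree. -/
structure Reduced {k : ℕ} (Q : ℕ) (a b : E → V) (S : Set V) (v : V) (D : V → ℕ)
    (P : E → Fin k) : Prop extends ExtData Q a b S v D P where
  large : 36 ≤ Q
  pos : 0 < k
  meets : ∀ e, a e ≠ b e → a e ∈ S ∨ b e ∈ S
  outside : ∀ t, t ∉ S → ((cut a b {t}).card ≤ 3 ∧ (cut a b {t}).card + 2 * k ≤ D t) ∨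
    (Q - 4) * k ≤ (cut a b {t}).card

/-- The vertices outside `S` of degree at most three. -/
def IsSmall (a b : E → V) (S : Set V) (t : V) : Prop := t ∉ S ∧ (cut a b {t}).card ≤ 3

/-- The vertices other than `v` which are not small. -/
abbrev Core (a b : E → V) (S : Set V) (v : V) : Type := {u : V // u ≠ v ∧ ¬ IsSmall a b S u}

open Classical in
/-- The small endpoint of an edge if there is one, and the edge itself otherwise. -/
noncomputable def owner (a b : E → V) (S : Set V) (e : E) : E ⊕ V :=
  if IsSmall a b S (a e) then Sum.inr (a e)
  else if IsSmall a b S (b e) then Sum.inr (b e) else Sum.inl e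

/-- Some edge owned by `x` that avoids `v` is incident to `u`. -/
def Meets (a b : E → V) (S : Set V) (v : V) (x : E ⊕ V) (u : V) : Prop :=
  ∃ e, owner a b S e = x ∧ e ∈ cut a b {u} ∧ e ∉ cut a b {v}

/-- Some edge owned by `x` is incident to `v`. -/
def Rooted (a b : E → V) (S : Set V) (v : V) (x : E ⊕ V) : Prop :=
  ∃ e, owner a b S e = x ∧ e ∈ cut a b {v}

/-- `x` meets two classes of `r`. -/
def Crosses (a b : E → V) (S : Set V) (v : V) (r : Setoid (Core a b S v)) (x : E ⊕ V) : Prop :=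
  ∃ u w : Core a b S v, Meets a b S v x u ∧ Meets a b S v x w ∧ ¬ r u w

variable {a b : E → V} {S : Set V} {v : V}

theorem owner_eq_inr {e : E} {t : V} (h : owner a b S e = Sum.inr t) :
    IsSmall a b S t ∧ (a e = t ∨ b e = t) := by
  unfold owner at h
  split_ifs at h with h1 h2
  · rw [Sum.inr.injEq] at h
    exact h ▸ ⟨h1, Or.inl rfl⟩
  · rw [Sum.inr.injEq] at h
    exact h ▸ ⟨h2, Or.inr rfl⟩

theorem owner_eq_inl {e e' : E} (h : owner a b S e = Sum.inl e') :
    e = e' ∧ ¬ IsSmall a b S (a e) ∧ ¬ IsSmall a b S (b e) := by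
  unfold owner at h
  split_ifs at h with h1 h2
  exact ⟨Sum.inl.inj h, h1, h2⟩

theorem mem_cut_otherEnd {t : V} {e : E} (he : e ∈ cut a b {t}) :
    e ∈ cut a b {otherEnd a b t e} := by
  rw [mem_cut_iff_otherEnd he]
  simp [(otherEnd_ne he).symm]

theorem not_isSmall_of_mem {s : V} (hs : s ∈ S) : ¬ IsSmall a b S s := fun h => h.1 hs

/-- Two edges with the same owner and not in the cut of `Y` have their ends on the same side. -/
theorem mem_iff_of_owner_eq {e e' : E} {u w : V} {Y : Set V} (ho : owner a b S e = owner a b S e')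
    (hu : ¬ IsSmall a b S u) (hw : ¬ IsSmall a b S w) (heu : e ∈ cut a b {u})
    (hew : e' ∈ cut a b {w}) (he : e ∉ cut a b Y) (he' : e' ∉ cut a b Y) : u ∈ Y ↔ w ∈ Y := by
  rw [mem_cut_singleton] at heu hew
  rw [mem_cut, not_not] at he he'
  rcases hx : owner a b S e' with e₁ | t
  · rw [hx] at ho
    obtain ⟨rfl, -⟩ := owner_eq_inl ho
    obtain ⟨rfl, -⟩ := owner_eq_inl hx
    grind
  · rw [hx] at ho
    have h1 := owner_eq_inr ho
    have h2 := owner_eq_inr hx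
    grind

variable {k Q : ℕ} {D : V → ℕ} {P : E → Fin k}

theorem Reduced.owner_of_mem_cut (h : Reduced Q a b S v D P)
    {t : V} (ht : IsSmall a b S t) {e : E} (he : e ∈ cut a b {t}) :
    owner a b S e = Sum.inr t := by
  rw [mem_cut_singleton] at he
  have hm := h.meets e (by grind)
  have h1 := ht.1
  have h2 := @not_isSmall_of_mem _ _ _ a b S
  unfold owner
  grind

theorem Reduced.otherEnd_mem (h : Reduced Q a b S v D P)
    {t : V} (ht : t ∉ S) {e : E} (he : e ∈ cut a b {t}) :
    otherEnd a b t e ∈ S := by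
  have h0 := otherEnd_cases he
  rw [mem_cut_singleton] at he
  have hm := h.meets e (by grind)
  grind

theorem Reduced.v_not_isSmall (h : Reduced Q a b S v D P) :
    ¬ IsSmall a b S v := not_isSmall_of_mem h.mem

theorem Reduced.mem_cut_v (h : Reduced Q a b S v D P)
    {t : V} (ht : IsSmall a b S t) {e : E} (he : e ∈ cut a b {t}) :
    e ∈ cut a b {v} ↔ otherEnd a b t e = v := by
  have htv : t ≠ v := fun hv => ht.1 (hv ▸ h.mem)
  rw [mem_cut_iff_otherEnd he]
  simp [htv]

/-- The neighbour of a small vertex along an edge avoiding `v` is in the core. -/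
theorem Reduced.otherEnd_core (h : Reduced Q a b S v D P)
    {t : V} (ht : IsSmall a b S t) {e : E} (he : e ∈ cut a b {t})
    (hv : e ∉ cut a b {v}) : otherEnd a b t e ≠ v ∧ ¬ IsSmall a b S (otherEnd a b t e) :=
  ⟨fun h' => hv ((h.mem_cut_v ht he).2 h'), not_isSmall_of_mem (h.otherEnd_mem ht.1 he)⟩

open Classical in
theorem Reduced.two_mul_card_le (h : Reduced Q a b S v D P)
    {t : V} (ht : t ∉ S) :
    2 * ((cut a b {t}).filter (· ∈ cut a b {v})).card ≤ (cut a b {t}).card := by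
  have htv : t ≠ v := fun hv => ht (hv ▸ h.mem)
  have h1 : (cut a b (insert t {v})).card + 2 * ((cut a b {t}).filter
      (otherEnd a b t · ∈ ({v} : Set V))).card = (cut a b {v}).card + (cut a b {t}).card := by
    convert card_cut_insert (a := a) (b := b) (t := t) {v} htv
  have h2 := h.conn (insert t {v}) (by
    obtain ⟨s, hs, hsv⟩ := h.other
    refine ⟨⟨v, h.mem, by simp⟩, s, hs, ?_⟩
    rintro (rfl | h')
    · exact ht hs
    · exact hsv h')
  have h3 : (cut a b {t}).filter (· ∈ cut a b {v}) ⊆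
      (cut a b {t}).filter (otherEnd a b t · ∈ ({v} : Set V)) := by
    intro e he
    rw [Finset.mem_filter] at he ⊢
    refine ⟨he.1, ?_⟩
    have := he.2
    rw [mem_cut_iff_otherEnd he.1] at this
    have h' : t ∉ ({v} : Set V) := htv
    tauto
  have h4 := Finset.card_le_card h3
  have h5 := h.card_cut_v
  omega

/-- Distinct edges at `v` have distinct owners. -/
theorem Reduced.owner_injOn (h : Reduced Q a b S v D P) :
    Set.InjOn (owner a b S) (cut a b {v}) := by
  classical
  intro e he e' he' ho
  rcases hx : owner a b S e' with e₁ | t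
  · rw [hx] at ho
    rw [(owner_eq_inl ho).1, (owner_eq_inl hx).1]
  · rw [hx] at ho
    have h1 := owner_eq_inr ho
    have h2 := owner_eq_inr hx
    have h3 := h.two_mul_card_le h1.1.1
    have h4 := h1.1.2
    have hv := h.v_not_isSmall
    have htv : t ≠ v := fun h' => hv (h' ▸ h1.1)
    have hc : ((cut a b {t}).filter (· ∈ cut a b {v})).card ≤ 1 := by omega
    refine Finset.card_le_one.1 hc e ?_ e' ?_
    all_goals
      rw [Finset.mem_coe] at he he'
      rw [Finset.mem_filter]
      refine ⟨?_, by assumption⟩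
      rw [mem_cut_singleton] at he he' ⊢
      grind

/-- A small vertex which is not isolated has an edge avoiding `v`. -/
theorem Reduced.exists_edge_of_isSmall (h : Reduced Q a b S v D P)
    {t : V} (ht : IsSmall a b S t) {e : E}
    (he : e ∈ cut a b {t}) : ∃ e' ∈ cut a b {t}, e' ∉ cut a b {v} := by
  classical
  by_contra! hno
  have h1 := h.two_mul_card_le ht.1
  rw [Finset.filter_true_of_mem hno] at h1
  have : 0 < (cut a b {t}).card := Finset.card_pos.2 ⟨e, he⟩
  omega

end Reduced

section Cost

variable {C E : Type}

open Classical in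
/-- The number of classes separated by an edge whose ends have classes `x` and `y`. -/
noncomputable def cost (x y : Option C) : ℕ :=
  if x = y then 0 else (if x = none then 0 else 1) + if y = none then 0 else 1

theorem cost_self (x : Option C) : cost x x = 0 := by simp [cost]

theorem cost_comm (x y : Option C) : cost x y = cost y x := by
  by_cases h : x = y
  · rw [h]
  · have h' : y ≠ x := fun h' => h h'.symm
    simp only [cost, if_neg h, if_neg h']
    exact add_comm _ _

theorem cost_none (y : Option C) : cost none y ≤ 1 := by
  unfold cost
  split_ifs <;> simp_all

theorem cost_le_two (x y : Option C) : cost x y ≤ 2 := by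
  unfold cost
  split_ifs <;> simp

open Classical in
theorem sum_le_cost [Fintype C] (x y : Option C) :
    ∑ c : C, (if ¬ (x = some c ↔ y = some c) then 1 else 0) ≤ cost x y := by
  by_cases hxy : x = y
  · simp [hxy]
  · have h1 : ∀ z : Option C, (if z = none then 0 else 1) =
        ∑ c : C, if z = some c then 1 else 0 := by
      rintro (_ | z)
      · simp
      · simp [Finset.sum_ite_eq]
    unfold cost
    rw [if_neg hxy, h1, h1, ← Finset.sum_add_distrib]
    refine Finset.sum_le_sum fun c _ => ?_
    split_ifs <;> simp_all

open Classical in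
/-- A small vertex can be assigned to a class so as to make the cost of its edges small. -/
theorem exists_assignment [Fintype C] (A : Finset E) (hA : A.card ≤ 3) (g : E → Option C)
    {B : ℕ} (hB : 2 ≤ B) (hB' : 3 ≤ B ∨ Fintype.card C ≤ 2) :
    ∃ x : Option C, ∑ e ∈ A, cost x (g e) ≤
      (if ∃ e ∈ A, ∃ f ∈ A, ∃ c d, c ≠ d ∧ g e = some c ∧ g f = some d then
        (if ∃ e ∈ A, g e = none then 1 else B) else 0) + (A.filter (g · = none)).card := by
  split_ifs with h1 h2
  · refine ⟨none, ?_⟩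
    obtain ⟨e, he, hg⟩ := h2
    have h3 : 0 < (A.filter (g · = none)).card := Finset.card_pos.2 ⟨e, by simp [he, hg]⟩
    have h4 := Finset.card_filter_add_card_filter_not (s := A) (fun e => g e = none)
    have h5 : ∑ e ∈ A, cost none (g e) ≤ (A.filter (¬ g · = none)).card := by
      rw [Finset.card_filter]
      refine Finset.sum_le_sum fun e _ => ?_
      split_ifs with hn
      · rw [hn, cost_self]
      · exact cost_none _
    omega
  · rcases hB' with hB' | hC
    · refine ⟨none, ?_⟩
      have : ∑ e ∈ A, cost none (g e) ≤ ∑ e ∈ A, 1 := Finset.sum_le_sum fun e _ => cost_none _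
      simp at this
      omega
    · obtain ⟨e₀, -, f₀, -, c, d, hcd, -⟩ := h1
      have hall : ∀ y, y = c ∨ y = d := by
        intro y
        by_contra! hy
        have := Finset.card_le_univ {y, c, d}
        rw [Finset.card_eq_three.2 ⟨y, c, d, hy.1, hy.2, hcd, rfl⟩] at this
        omega
      have key : ∀ x, ∑ e ∈ A, cost (some x) (g e) ≤ 2 * (A.filter (g · ≠ some x)).card := by
        intro x
        rw [Finset.card_filter, Finset.mul_sum]
        refine Finset.sum_le_sum fun e _ => ?_
        split_ifs with hx
        · exact cost_le_two _ _
        · rw [not_not.1 hx, cost_self, mul_zero]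
      have hsum : (A.filter (g · ≠ some c)).card + (A.filter (g · ≠ some d)).card ≤ A.card := by
        rw [← Finset.card_union_of_disjoint]
        · exact Finset.card_le_card (Finset.union_subset (Finset.filter_subset _ _)
            (Finset.filter_subset _ _))
        · rw [Finset.disjoint_left]
          intro e he he'
          rw [Finset.mem_filter] at he he'
          rcases hg : g e with _ | y
          · exact h2 ⟨e, he.1, hg⟩
          · rcases hall y with rfl | rfl
            · exact he.2 hg
            · exact he'.2 hg
      have hc := key c
      have hd := key d
      rcases Nat.lt_or_ge 1 (A.filter (g · ≠ some c)).card with h3 | h3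
      · exact ⟨some d, by omega⟩
      · exact ⟨some c, by omega⟩
  · by_cases h2 : ∃ e ∈ A, ∃ c, g e = some c
    · obtain ⟨e, he, c, hc⟩ := h2
      refine ⟨some c, ?_⟩
      rw [Finset.card_filter, zero_add]
      refine Finset.sum_le_sum fun f hf => ?_
      rcases hg : g f with _ | d
      · rw [cost_comm]
        simpa using cost_none _
      · by_cases hcd : c = d
        · rw [hcd, cost_self]
          exact Nat.zero_le _
        · exact absurd ⟨e, he, f, hf, c, d, hcd, hc, hg⟩ h1
    · refine ⟨none, ?_⟩
      rw [Finset.sum_eq_zero]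
      · exact Nat.zero_le _
      · intro e he
        rcases hg : g e with _ | d
        · exact cost_self _
        · exact absurd ⟨e, he, d, hg⟩ h2

end Cost

section Count

variable [Fintype E] {a b : E → V} {S : Set V} {v : V} {k Q : ℕ} {D : V → ℕ}
  {P : E → Fin k}

open Classical in
/-- The class of a core vertex. -/
noncomputable def coreClass (r : Setoid (Core a b S v)) (x : V) : Option (Quotient r) :=
  if hx : x ≠ v ∧ ¬ IsSmall a b S x then some (Quotient.mk r ⟨x, hx⟩) else none

theorem coreClass_eq_some {r : Setoid (Core a b S v)} {x : V} {c : Quotient r}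
    (hx : coreClass r x = some c) :
    ∃ hx : x ≠ v ∧ ¬ IsSmall a b S x, Quotient.mk r ⟨x, hx⟩ = c := by
  unfold coreClass at hx
  split_ifs at hx with h
  exact ⟨h, Option.some.inj hx⟩

theorem coreClass_v (r : Setoid (Core a b S v)) : coreClass r v = none := by
  simp [coreClass]

theorem coreClass_coe (r : Setoid (Core a b S v)) (u : Core a b S v) :
    coreClass r u = some (Quotient.mk r u) := by
  simp [coreClass, u.2]

open Classical in
/-- The cost of the edges owned by `x`, for a suitable assignment of the small vertices. -/
theorem Reduced.exists_classes (h : Reduced Q a b S v D P)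
    [Fintype V] (r : Setoid (Core a b S v)) {B : ℕ} (hB : 2 ≤ B)
    (hB' : 3 ≤ B ∨ Nat.card (Quotient r) ≤ 2) :
    ∃ κ : V → Option (Quotient r), (∀ x, ¬ IsSmall a b S x → κ x = coreClass r x) ∧
      ∀ x, ∑ e with owner a b S e = x, cost (κ (a e)) (κ (b e)) ≤
        (if Crosses a b S v r x then (if Rooted a b S v x then 1 else B) else 0) +
        ((cut a b {v}).filter (owner a b S · = x)).card := by
  have hex := fun t (ht : IsSmall a b S t) => exists_assignment (cut a b {t}) ht.2
    (fun e => coreClass r (otherEnd a b t e)) hB (by rwa [Nat.card_eq_fintype_card] at hB')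
  choose f hf using hex
  refine ⟨fun x => if hx : IsSmall a b S x then f x hx else coreClass r x,
    fun x hx => dif_neg hx, ?_⟩
  rintro (e₁ | t)
  · have hs : ∀ e, owner a b S e = Sum.inl e₁ → e = e₁ := fun e he => (owner_eq_inl he).1
    by_cases ho : owner a b S e₁ = Sum.inl e₁
    · have hf1 : (Finset.univ.filter fun e => owner a b S e = Sum.inl e₁) = {e₁} := by
        ext e
        simp only [Finset.mem_filter, Finset.mem_univ, true_and, Finset.mem_singleton]
        exact ⟨hs e, fun he => he ▸ ho⟩
      rw [hf1, Finset.sum_singleton]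
      obtain ⟨-, ha, hb⟩ := owner_eq_inl ho
      beta_reduce
      rw [dif_neg ha, dif_neg hb]
      by_cases hv : e₁ ∈ cut a b {v}
      · have h1 : 0 < ((cut a b {v}).filter (owner a b S · = Sum.inl e₁)).card :=
          Finset.card_pos.2 ⟨e₁, by simp [hv, ho]⟩
        have h2 : cost (coreClass r (a e₁)) (coreClass r (b e₁)) ≤ 1 := by
          rw [mem_cut_singleton] at hv
          by_cases hav : a e₁ = v
          · rw [hav, coreClass_v]
            exact cost_none _
          · have hbv : b e₁ = v := by tauto
            rw [hbv, coreClass_v, cost_comm]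
            exact cost_none _
        omega
      · by_cases hc : coreClass r (a e₁) = coreClass r (b e₁)
        · rw [hc, cost_self]
          exact Nat.zero_le _
        · have hav : a e₁ ≠ v ∧ b e₁ ≠ v := by
            have := hv
            rw [mem_cut_singleton, not_not] at this
            constructor <;> intro h' <;> apply hc <;> grind
          have hab : a e₁ ≠ b e₁ := fun h' => hc (by rw [h'])
          have hcr : Crosses a b S v r (Sum.inl e₁) := by
            refine ⟨⟨a e₁, hav.1, ha⟩, ⟨b e₁, hav.2, hb⟩, ⟨e₁, ho, ?_, hv⟩, ⟨e₁, ho, ?_, hv⟩, ?_⟩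
            · rw [mem_cut_singleton]; simp [hab.symm]
            · rw [mem_cut_singleton]; simp [hab]
            · intro hr
              apply hc
              have h1 := coreClass_coe r ⟨a e₁, hav.1, ha⟩
              have h2 := coreClass_coe r ⟨b e₁, hav.2, hb⟩
              rw [Quotient.sound hr] at h1
              exact h1.trans h2.symm
          have hnr : ¬ Rooted a b S v (Sum.inl e₁) := by
            rintro ⟨e, he, hev⟩
            rw [hs e he] at hev
            exact hv hev
          rw [if_pos hcr, if_neg hnr]
          have := cost_le_two (coreClass r (a e₁)) (coreClass r (b e₁))
          omega
    · rw [Finset.sum_eq_zero]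
      · exact Nat.zero_le _
      · intro e he
        have he := (Finset.mem_filter.1 he).2
        exact absurd (hs e he ▸ he) ho
  · by_cases ht : IsSmall a b S t
    · have h1 : ∑ e with owner a b S e = Sum.inr t,
          cost (if hx : IsSmall a b S (a e) then f (a e) hx else coreClass r (a e))
            (if hx : IsSmall a b S (b e) then f (b e) hx else coreClass r (b e)) ≤
          ∑ e ∈ cut a b {t}, cost (f t ht) (coreClass r (otherEnd a b t e)) := by
        have h2 : cut a b {t} ⊆ Finset.univ.filter fun e => owner a b S e = Sum.inr t := by
          intro e he
          simp [h.owner_of_mem_cut ht he]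
        rw [← Finset.sum_subset h2]
        · refine Finset.sum_le_sum fun e he => ?_
          have h3 := not_isSmall_of_mem (a := a) (b := b) (h.otherEnd_mem ht.1 he)
          rcases otherEnd_cases he with ⟨h4, h5⟩ | ⟨h4, h5⟩
          · simp only [h4, h5, dif_neg h3, dif_pos ht, le_refl]
          · simp only [h4, h5, dif_neg h3, dif_pos ht]
            rw [cost_comm]
        · intro e he he'
          have h3 := (owner_eq_inr (Finset.mem_filter.1 he).2).2
          rw [mem_cut_singleton, not_not] at he'
          have h4 : a e = t := by tauto
          have h5 : b e = t := by tauto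
          simp only [h4, h5, cost_self]
      refine h1.trans ((hf t ht).trans ?_)
      have h2 : ((cut a b {t}).filter fun e => coreClass r (otherEnd a b t e) = none) =
          (cut a b {v}).filter (owner a b S · = Sum.inr t) := by
        ext e
        simp only [Finset.mem_filter]
        constructor
        · rintro ⟨he, hc⟩
          refine ⟨?_, h.owner_of_mem_cut ht he⟩
          by_contra hv
          unfold coreClass at hc
          rw [dif_pos (h.otherEnd_core ht he hv)] at hc
          simp at hc
        · rintro ⟨he, ho⟩
          have het : e ∈ cut a b {t} := by
            have h3 := (owner_eq_inr ho).2
            have h4 : t ≠ v := fun h' => h.v_not_isSmall (h' ▸ ht)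
            rw [mem_cut_singleton] at he ⊢
            grind
          refine ⟨het, ?_⟩
          rw [(h.mem_cut_v ht het).1 he, coreClass_v]
      rw [h2]
      refine Nat.add_le_add_right ?_ _
      by_cases hc : ∃ e ∈ cut a b {t}, ∃ f ∈ cut a b {t}, ∃ c d, c ≠ d ∧
          coreClass r (otherEnd a b t e) = some c ∧ coreClass r (otherEnd a b t f) = some d
      · have hcr : Crosses a b S v r (Sum.inr t) := by
          obtain ⟨e, he, f, hf, c, d, hcd, hec, hfd⟩ := hc
          obtain ⟨hx, hxc⟩ := coreClass_eq_some hec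
          obtain ⟨hy, hyd⟩ := coreClass_eq_some hfd
          refine ⟨⟨_, hx⟩, ⟨_, hy⟩, ⟨e, h.owner_of_mem_cut ht he, mem_cut_otherEnd he, ?_⟩,
            ⟨f, h.owner_of_mem_cut ht hf, mem_cut_otherEnd hf, ?_⟩, fun hr => hcd ?_⟩
          · exact fun hv => hx.1 ((h.mem_cut_v ht he).1 hv)
          · exact fun hv => hy.1 ((h.mem_cut_v ht hf).1 hv)
          · rw [← hxc, ← hyd]
            exact Quotient.sound hr
        rw [if_pos hc, if_pos hcr]
        by_cases hR : Rooted a b S v (Sum.inr t)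
        · have hn : ∃ e ∈ cut a b {t}, coreClass r (otherEnd a b t e) = none := by
            obtain ⟨e, ho, he⟩ := hR
            have : e ∈ (cut a b {v}).filter (owner a b S · = Sum.inr t) := by simp [ho, he]
            rw [← h2, Finset.mem_filter] at this
            exact ⟨e, this⟩
          rw [if_pos hn, if_pos hR]
        · rw [if_neg hR]
          split_ifs <;> omega
      · rw [if_neg hc]
        exact Nat.zero_le _
    · rw [Finset.sum_eq_zero]
      · exact Nat.zero_le _
      · intro e he
        exact absurd (owner_eq_inr (Finset.mem_filter.1 he).2).1 ht

end Count

section Crossing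

variable [Fintype E] {a b : E → V} {S : Set V} {v : V} {k Q : ℕ}
  {D : V → ℕ} {P : E → Fin k}

section Cuts

theorem Reduced.conn_le_card_cut (h : Reduced Q a b S v D P)
    (r : Setoid (Core a b S v)) {κ : V → Option (Quotient r)}
    (hκ : ∀ x, ¬ IsSmall a b S x → κ x = coreClass r x) {c : Quotient r}
    (hc : ∃ u : Core a b S v, u.1 ∈ S ∧ Quotient.mk r u = c) :
    Q * k ≤ (cut a b {x | κ x = some c}).card := by
  obtain ⟨u, hu, rfl⟩ := hc
  refine h.conn _ ⟨⟨u, hu, ?_⟩, v, h.mem, ?_⟩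
  · rw [Set.mem_ofPred_eq, hκ _ u.2.2, coreClass_coe]
  · rw [Set.mem_ofPred_eq, hκ _ h.v_not_isSmall, coreClass_v]
    simp

theorem Reduced.le_card_cut (h : Reduced Q a b S v D P)
    (r : Setoid (Core a b S v)) {κ : V → Option (Quotient r)}
    (hκ : ∀ x, ¬ IsSmall a b S x → κ x = coreClass r x) (c : Quotient r) :
    (Q - 4) * k ≤ (cut a b {x | κ x = some c}).card := by
  by_cases hc : ∃ u : Core a b S v, u.1 ∈ S ∧ Quotient.mk r u = c
  · exact (Nat.mul_le_mul_right k (Nat.sub_le Q 4)).trans (h.conn_le_card_cut r hκ hc)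
  · induction c using Quotient.ind with | _ u =>
    have hu : u.1 ∉ S := fun hu => hc ⟨u, hu, rfl⟩
    have hd : (Q - 4) * k ≤ (cut a b {u.1}).card :=
      (h.outside u hu).resolve_left fun h' => u.2.2 ⟨hu, h'.1⟩
    refine hd.trans (Finset.card_le_card fun e he => ?_)
    rw [mem_cut_iff_otherEnd he]
    have h1 : κ u = some (Quotient.mk r u) := by rw [hκ _ u.2.2, coreClass_coe]
    have h2 : κ (otherEnd a b u e) ≠ some (Quotient.mk r u) := by
      have h3 := h.otherEnd_mem hu he
      rw [hκ _ (not_isSmall_of_mem h3)]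
      intro h4
      obtain ⟨hx, h5⟩ := coreClass_eq_some h4
      exact hc ⟨_, h3, h5⟩
    simp [h1, h2]

end Cuts

variable [Fintype V]

open Classical in
/-- The crossing elements not incident to `v`. -/
noncomputable def freeCrossing (a b : E → V) (S : Set V) (v : V) (r : Setoid (Core a b S v)) :
    Finset (E ⊕ V) :=
  Finset.univ.filter fun x => Crosses a b S v r x ∧ ¬ Rooted a b S v x

open Classical in
/-- The crossing elements incident to `v`. -/
noncomputable def rootedCrossing (a b : E → V) (S : Set V) (v : V) (r : Setoid (Core a b S v)) :
    Finset (E ⊕ V) :=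
  Finset.univ.filter fun x => Crosses a b S v r x ∧ Rooted a b S v x

theorem mem_freeCrossing {r : Setoid (Core a b S v)} {x : E ⊕ V} :
    x ∈ freeCrossing a b S v r ↔ Crosses a b S v r x ∧ ¬ Rooted a b S v x := by
  simp [freeCrossing]

theorem mem_rootedCrossing {r : Setoid (Core a b S v)} {x : E ⊕ V} :
    x ∈ rootedCrossing a b S v r ↔ Crosses a b S v r x ∧ Rooted a b S v x := by
  simp [rootedCrossing]

open Classical in
theorem card_rootedCrossing_le (r : Setoid (Core a b S v)) :
    (rootedCrossing a b S v r).card ≤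
      ((cut a b {v}).filter (owner a b S · ∈ rootedCrossing a b S v r)).card := by
  refine (Finset.card_le_card ?_).trans (Finset.card_image_le (f := owner a b S))
  intro x hx
  obtain ⟨e, he, hev⟩ := (mem_rootedCrossing.1 hx).2
  exact Finset.mem_image.2 ⟨e, Finset.mem_filter.2 ⟨hev, he ▸ hx⟩, he⟩

theorem Reduced.card_mul_le (h : Reduced Q a b S v D P)
    (r : Setoid (Core a b S v)) {B m : ℕ} (hB : 2 ≤ B)
    (hB' : 3 ≤ B ∨ Nat.card (Quotient r) ≤ 2)
    (hm : ∀ κ : V → Option (Quotient r), (∀ x, ¬ IsSmall a b S x → κ x = coreClass r x) →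
      ∀ c, m ≤ (cut a b {x | κ x = some c}).card) :
    Nat.card (Quotient r) * m ≤ B * (freeCrossing a b S v r).card + Q * k +
      (rootedCrossing a b S v r).card := by
  classical
  obtain ⟨κ, hκ, hsum⟩ := h.exists_classes r hB hB'
  calc Nat.card (Quotient r) * m = ∑ c : Quotient r, m := by simp
    _ ≤ ∑ c : Quotient r, (cut a b {x | κ x = some c}).card :=
      Finset.sum_le_sum fun c _ => hm κ hκ c
    _ = ∑ e, ∑ c : Quotient r,
        (if ¬ (κ (a e) = some c ↔ κ (b e) = some c) then 1 else 0) := by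
      simp only [card_cut, mem_cut, Set.mem_ofPred_eq]
      exact Finset.sum_comm
    _ ≤ ∑ e, cost (κ (a e)) (κ (b e)) := Finset.sum_le_sum fun e _ => by
      refine le_trans (le_of_eq (Finset.sum_congr rfl fun c _ => ?_)) (sum_le_cost _ _)
      congr
    _ = ∑ x, ∑ e with owner a b S e = x, cost (κ (a e)) (κ (b e)) :=
      (Finset.sum_fiberwise _ _ _).symm
    _ ≤ ∑ x, ((if x ∈ freeCrossing a b S v r then B else 0) +
        (if x ∈ rootedCrossing a b S v r then 1 else 0) +
        ((cut a b {v}).filter (owner a b S · = x)).card) := by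
      refine Finset.sum_le_sum fun x _ => (hsum x).trans (Nat.add_le_add_right ?_ _)
      simp only [mem_freeCrossing, mem_rootedCrossing]
      split_ifs <;> simp_all
    _ = _ := by
      rw [Finset.sum_add_distrib, Finset.sum_add_distrib,
        ← Finset.card_eq_sum_card_fiberwise (fun _ _ => Finset.mem_coe.2 (Finset.mem_univ _)),
        h.card_cut_v]
      simp only [Finset.sum_ite_mem, Finset.univ_inter, Finset.sum_const, smul_eq_mul, mul_one]
      ring

theorem Reduced.two_mul_card_quotient_le (h : Reduced Q a b S v D P)
    (r : Setoid (Core a b S v)) (hr : 3 ≤ Nat.card (Quotient r)) :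
    2 * k * (Nat.card (Quotient r) - 1) ≤ (freeCrossing a b S v r).card := by
  classical
  have h1 := h.card_mul_le r (B := 3) (by norm_num) (Or.inl le_rfl)
    (fun κ hκ => h.le_card_cut r hκ)
  have h2 := (card_rootedCrossing_le r).trans (Finset.card_filter_le _ _)
  rw [h.card_cut_v] at h2
  obtain ⟨q, rfl⟩ := Nat.exists_eq_add_of_le h.large
  obtain ⟨p, hp⟩ := Nat.exists_eq_add_of_le hr
  rw [hp] at h1 ⊢
  rw [show 36 + q - 4 = 32 + q by omega] at h1
  rw [show 3 + p - 1 = 2 + p by omega]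
  nlinarith [Nat.zero_le (p * k), Nat.zero_le (p * q * k), Nat.zero_le (q * k)]

theorem Reduced.conn_le_of_card_quotient_eq_two (h : Reduced Q a b S v D P)
    (r : Setoid (Core a b S v))
    (hr : Nat.card (Quotient r) = 2) (hO : (freeCrossing a b S v r).card < 2 * k) :
    Q * k ≤ 2 * (freeCrossing a b S v r).card + (rootedCrossing a b S v r).card := by
  by_cases hc : ∀ c, ∃ u : Core a b S v, u.1 ∈ S ∧ Quotient.mk r u = c
  · have h1 := h.card_mul_le r (B := 2) le_rfl (Or.inr hr.le)
      (fun κ hκ c => h.conn_le_card_cut r hκ (hc c))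
    rw [hr] at h1
    omega
  · exfalso
    push Not at hc
    obtain ⟨c, hc⟩ := hc
    have hY : rootedCrossing a b S v r = ∅ := by
      by_contra hne
      obtain ⟨x, hx⟩ := Finset.nonempty_iff_ne_empty.2 hne
      obtain ⟨⟨u, w, ⟨e, he, heu, hev⟩, ⟨f, hf, hfw, hfv⟩, huw⟩, g, hg, hgv⟩ :=
        mem_rootedCrossing.1 hx
      rcases x with e₁ | t
      · rw [← (owner_eq_inl hg).1] at he
        rw [(owner_eq_inl he).1] at hev
        exact hev hgv
      · have ht := (owner_eq_inr he).1
        have hS : ∀ (u : Core a b S v) (e : E), owner a b S e = Sum.inr t →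
            e ∈ cut a b {u.1} → u.1 ∈ S := by
          intro u e he heu
          have h1 := (owner_eq_inr he).2
          have h2 : t ≠ u := fun h' => u.2.2 (h' ▸ ht)
          have h3 := ht.1
          rw [mem_cut_singleton] at heu
          have h4 := h.meets e (by grind)
          grind
        have h1 := hc u (hS u e he heu)
        have h2 := hc w (hS w f hf hfw)
        obtain ⟨y, z, hyz, huniv⟩ := Nat.card_eq_two_iff.1 hr
        have h3 : Quotient.mk r u ≠ Quotient.mk r w := fun h' => huw (Quotient.exact h')
        have hmem : ∀ q, q = y ∨ q = z := fun q => by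
          have : q ∈ ({y, z} : Set _) := huniv ▸ Set.mem_univ q
          simpa using this
        rcases hmem c with h4 | h4 <;> rcases hmem (Quotient.mk r u) with h5 | h5 <;>
          rcases hmem (Quotient.mk r w) with h6 | h6 <;> simp_all
    have h1 := h.card_mul_le r (B := 3) (by norm_num) (Or.inl le_rfl)
      (fun κ hκ => h.le_card_cut r hκ)
    rw [hY, hr] at h1
    obtain ⟨q, rfl⟩ := Nat.exists_eq_add_of_le h.large
    rw [show 36 + q - 4 = 32 + q by omega, Finset.card_empty] at h1
    have := h.pos
    nlinarith [Nat.zero_le (q * k)]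

end Crossing

section Assembly

theorem sum_max_two_le {E : Type} [Fintype E] {k : ℕ} (A : Finset E) (c : E → Option (Fin k)) :
    ∑ i, max 2 (A.filter (c · = some i)).card ≤ 2 * k + (A.filter (c · ≠ none)).card := by
  classical
  have h1 : (A.filter (c · ≠ none)).card = ∑ i, (A.filter (c · = some i)).card := by
    rw [← Finset.card_biUnion]
    · congr 1
      ext e
      rcases hc : c e with _ | i <;> simp [hc]
    · intro i _ j _ hij
      rw [Function.onFun, Finset.disjoint_left]
      intro e he he'
      rw [Finset.mem_filter] at he he'
      exact hij (Option.some.inj (he.2.symm.trans he'.2))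
  calc ∑ i, max 2 (A.filter (c · = some i)).card
      ≤ ∑ i, (2 + (A.filter (c · = some i)).card) := Finset.sum_le_sum fun i _ => by omega
    _ = _ := by
      rw [Finset.sum_add_distrib, h1]
      simp [mul_comm]

theorem sum_max_two_le_of_two_le {E : Type} [Fintype E] {k : ℕ} (A : Finset E)
    (c : E → Option (Fin k)) (h : ∀ i, 2 ≤ (A.filter (c · = some i)).card) :
    ∑ i, max 2 (A.filter (c · = some i)).card ≤ A.card := by
  classical
  calc ∑ i, max 2 (A.filter (c · = some i)).card
      = ∑ i, (A.filter (c · = some i)).card :=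
        Finset.sum_congr rfl fun i _ => max_eq_right (h i)
    _ ≤ ∑ x, (A.filter (c · = x)).card := by
      rw [Fintype.sum_option]
      exact Nat.le_add_left _ _
    _ = A.card := (Finset.card_eq_sum_card_fiberwise fun _ _ => by simp).symm

variable [Fintype E] {a b : E → V} {S : Set V} {v : V} {k Q : ℕ}
  {D : V → ℕ} {P : E → Fin k}

/-- A packing of the owners yields a good colouring: each edge takes the colour of its owner,
except for the dropped ones. -/
theorem Reduced.exists_coloring_of_packing (h : Reduced Q a b S v D P)
    (colI : E ⊕ V → Fin k) (drop : Finset E) (s : Setoid (Core a b S v))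
    (φ : E ⊕ V → Fin k × Bool) (avail : E ⊕ V → Prop)
    (hcol : ∀ e ∈ cut a b {v}, colI (owner a b S e) = P e)
    (havail : ∀ x, avail x → colI x = (φ x).1 ∧ ∀ e, owner a b S e = x → e ∉ drop)
    (hdrop : ∀ e ∈ drop, e ∉ cut a b {v})
    (hsmall : ∀ t, IsSmall a b S t → ∀ e ∈ cut a b {t}, e ∈ cut a b {v} →
      ∃ f ∈ cut a b {t}, f ∉ cut a b {v} ∧ f ∉ drop)
    (hφ : ∀ j (Y : Set (Core a b S v)), (∀ x, φ x = j → ∀ u w : Core a b S v,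
      avail x ∧ Meets a b S v x u ∧ Meets a b S v x w ∧ s u w → (u ∈ Y ↔ w ∈ Y)) →
        ∀ u w, s u w → (u ∈ Y ↔ w ∈ Y))
    (hcon : ∀ i u w, s u w ∨ ∃ e f, ∃ u' w' : Core a b S v, owner a b S e = owner a b S f ∧
      colI (owner a b S e) = i ∧ (e ∉ cut a b {v} ∧ e ∉ drop ∧ e ∈ cut a b {u'.1}) ∧
      (f ∉ cut a b {v} ∧ f ∉ drop ∧ f ∈ cut a b {w'.1}) ∧ s u u' ∧ s w' w)
    (hbal : ∀ u : Core a b S v, (∃ w, w ≠ u ∧ s u w) ∨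
      (∃ T ⊆ drop, T ⊆ cut a b {u.1} ∧ 2 * k ≤ T.card) ∨ ∀ w, w = u) :
    ∃ c, GoodColoring a b S v D P c := by
  classical
  let c : E → Option (Fin k) := fun e =>
    if e ∈ cut a b {v} then some (P e) else if e ∈ drop then none else some (colI (owner a b S e))
  have hcv : ∀ e ∈ cut a b {v}, c e = some (P e) := fun e he => if_pos he
  have hcd : ∀ e ∈ drop, c e = none := fun e he => by
    simp only [c, if_neg (hdrop e he), if_pos he]
  have hcn : ∀ e, e ∉ drop → c e = some (colI (owner a b S e)) := fun e he => by
    by_cases hv : e ∈ cut a b {v}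
    · rw [hcv e hv, hcol e hv]
    · simp only [c, if_neg hv, if_neg he]
  have hsm : ∀ t, IsSmall a b S t → ∀ e ∈ cut a b {t}, e ∈ cut a b {v} →
      ∃ f ∈ cut a b {t}, f ∉ cut a b {v} ∧ c f = some (P e) := by
    intro t ht e he hev
    obtain ⟨f, hf, hfv, hfd⟩ := hsmall t ht e he hev
    refine ⟨f, hf, hfv, ?_⟩
    rw [hcn f hfd, h.owner_of_mem_cut ht hf, ← h.owner_of_mem_cut ht he, hcol e hev]
  refine ⟨c, hcv, fun i Y hvY hY => ?_, fun u => ?_⟩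
  · have key : ∀ e f, ∀ u w : Core a b S v, owner a b S e = owner a b S f →
        colI (owner a b S e) = i → (e ∉ cut a b {v} ∧ e ∉ drop ∧ e ∈ cut a b {u.1}) →
        (f ∉ cut a b {v} ∧ f ∉ drop ∧ f ∈ cut a b {w.1}) → (u.1 ∈ Y ↔ w.1 ∈ Y) := by
      rintro e f u w ho hi ⟨h1, h2, h3⟩ ⟨h4, h5, h6⟩
      refine mem_iff_of_owner_eq ho u.2.2 w.2.2 h3 h6 (hY e ?_ h1) (hY f ?_ h4)
      · rw [hcn e h2, hi]
      · rw [hcn f h5, ← ho, hi]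
    have key2 : ∀ u w : Core a b S v, s u w → (u.1 ∈ Y ↔ w.1 ∈ Y) := by
      refine hφ (i, true) (Subtype.val ⁻¹' Y) ?_
      rintro x hx u w ⟨hav, ⟨e, he, heu, hev⟩, ⟨f, hf, hfw, hfv⟩, -⟩
      obtain ⟨h1, h2⟩ := havail x hav
      rw [hx] at h1
      exact key e f u w (he.trans hf.symm) (he ▸ h1) ⟨hev, h2 e he, heu⟩ ⟨hfv, h2 f hf, hfw⟩
    have key3 : ∀ u w : Core a b S v, u.1 ∈ Y ↔ w.1 ∈ Y := by
      intro u w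
      rcases hcon i u w with hs | ⟨e, f, u', w', ho, hi, he, hf, hu, hw⟩
      · exact key2 u w hs
      · exact (key2 _ _ hu).trans ((key e f u' w' ho hi he hf).trans (key2 _ _ hw))
    have key4 : ∀ x, Terminal a b S v c i x → ∃ u : Core a b S v, x ∈ Y ↔ u.1 ∈ Y := by
      rintro x ⟨hxv, hx⟩
      by_cases hxs : IsSmall a b S x
      · rcases hx with hx | ⟨e, hei, he⟩
        · exact absurd hx hxs.1
        · have hex : e ∈ cut a b {x} := by rw [mem_cut_singleton]; grind
          have hev : e ∈ cut a b {v} := by rw [mem_cut_singleton]; grind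
          obtain ⟨f, hf, hfv, hfi⟩ := hsm x hxs e hex hev
          refine ⟨⟨_, h.otherEnd_core hxs hf hfv⟩, ?_⟩
          have := hY f (by rw [hfi, ← hcv e hev, hei]) hfv
          rw [mem_cut_iff_otherEnd hf] at this
          tauto
      · exact ⟨⟨x, hxv, hxs⟩, Iff.rfl⟩
    by_cases hall : ∀ x, Terminal a b S v c i x → x ∈ Y
    · exact Or.inl hall
    · right
      push Not at hall
      obtain ⟨x, hx, hxY⟩ := hall
      obtain ⟨u, hu⟩ := key4 x hx
      intro y hy
      obtain ⟨w, hw⟩ := key4 y hy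
      rw [hw, ← key3 u w, ← hu]
      exact hxY
  · by_cases huv : u = v
    · subst huv
      refine (sum_max_two_le_of_two_le _ c fun i => ?_).trans (h.le_D u)
      rw [show (cut a b {u}).filter (c · = some i) = (cut a b {u}).filter (P · = i) from
        Finset.filter_congr fun e he => by rw [hcv e he, Option.some.injEq]]
      exact h.twice i
    by_cases hus : IsSmall a b S u
    · refine (sum_max_two_le _ c).trans ?_
      have h1 : (cut a b {u}).card + 2 * k ≤ D u := by
        rcases h.outside u hus.1 with h1 | h1
        · exact h1.2
        · have h2 := hus.2
          have h3 := h.large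
          have h4 := h.pos
          have : 32 * 1 ≤ (Q - 4) * k := Nat.mul_le_mul (by omega) h4
          omega
      have h2 := Finset.card_filter_le (cut a b {u}) (c · ≠ none)
      omega
    · obtain ⟨w, hwu, hs⟩ | ⟨T, hT, hTu, hTk⟩ | hall := hbal ⟨u, huv, hus⟩
      · refine (sum_max_two_le_of_two_le _ c fun i => ?_).trans (h.le_D u)
        have hex : ∀ o, ∃ e ∈ cut a b {u}, c e = some i ∧ φ (owner a b S e) = (i, o) := by
          intro o
          by_contra! hno
          have := hφ (i, o) {⟨u, huv, hus⟩} ?_ _ _ hs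
          · simp [hwu] at this
          · rintro x hx y z ⟨hav, ⟨e, he, hey, hev⟩, ⟨f, hf, hfz, hfv⟩, -⟩
            have hgen : ∀ (y : Core a b S v) e, owner a b S e = x → e ∈ cut a b {y.1} →
                y ∉ ({⟨u, huv, hus⟩} : Set (Core a b S v)) := by
              rintro y e he hey rfl
              refine hno e hey ?_ (he ▸ hx)
              rw [hcn e ((havail x hav).2 e he), he, (havail x hav).1, hx]
            simp only [hgen y e he hey, hgen z f hf hfz]
        obtain ⟨e, he, hei, heo⟩ := hex true
        obtain ⟨f, hf, hfi, hfo⟩ := hex false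
        have hef : e ≠ f := by
          rintro rfl
          rw [heo] at hfo
          simp at hfo
        exact Finset.one_lt_card.2 ⟨e, by simp [he, hei], f, by simp [hf, hfi], hef⟩
      · refine (sum_max_two_le _ c).trans (le_trans ?_ (h.le_D u))
        have h1 : (cut a b {u}).filter (c · ≠ none) ⊆ cut a b {u} \ T := by
          intro e he
          rw [Finset.mem_filter] at he
          rw [Finset.mem_sdiff]
          exact ⟨he.1, fun heT => he.2 (hcd e (hT heT))⟩
        have h2 := Finset.card_le_card h1
        have h3 : _ = (cut a b {u}).card := Finset.card_sdiff_add_card_eq_card hTu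
        omega
      · refine (sum_max_two_le_of_two_le _ c fun i => ?_).trans (h.le_D u)
        refine (h.twice i).trans ?_
        have hex : ∀ e ∈ (cut a b {v}).filter (P · = i),
            ∃ f ∈ cut a b {u}, c f = some i ∧ owner a b S f = owner a b S e := by
          intro e he
          rw [Finset.mem_filter] at he
          obtain ⟨hev, hei⟩ := he
          have h1 : otherEnd a b v e ≠ v := otherEnd_ne hev
          have h2 := mem_cut_otherEnd hev
          by_cases hys : IsSmall a b S (otherEnd a b v e)
          · obtain ⟨f, hf, hfv, hfi⟩ := hsm _ hys e h2 hev
            have h3 := hall ⟨_, h.otherEnd_core hys hf hfv⟩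
            have h4 := mem_cut_otherEnd hf
            rw [Subtype.mk.inj h3] at h4
            refine ⟨f, h4, by rw [hfi, hei], ?_⟩
            rw [h.owner_of_mem_cut hys hf, h.owner_of_mem_cut hys h2]
          · have h3 := Subtype.mk.inj (hall ⟨_, h1, hys⟩)
            rw [h3] at h2
            exact ⟨e, h2, by rw [hcv e hev, hei], rfl⟩
        choose! g hg using hex
        refine Finset.card_le_card_of_injOn g (fun e he => ?_) fun e he e' he' hee => ?_
        · have := hg e he
          simp [this.1, this.2.1]
        · refine h.owner_injOn (Finset.mem_filter.1 he).1 (Finset.mem_filter.1 he').1 ?_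
          rw [← (hg e he).2.2, ← (hg e' he').2.2, hee]

end Assembly

section Packing

variable [Fintype E] {a b : E → V} {S : Set V} {v : V} {k Q : ℕ}
  {D : V → ℕ} {P : E → Fin k}

theorem Reduced.exists_root_color (h : Reduced Q a b S v D P) :
    ∃ col : E ⊕ V → Fin k, ∀ e ∈ cut a b {v}, col (owner a b S e) = P e := by
  classical
  refine ⟨fun x => if hx : Rooted a b S v x then P hx.choose else ⟨0, h.pos⟩, fun e he => ?_⟩
  have hx : Rooted a b S v (owner a b S e) := ⟨e, rfl, he⟩
  beta_reduce
  rw [dif_pos hx, h.owner_injOn hx.choose_spec.2 he hx.choose_spec.1]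

/-- Every edge owned by a small vertex meets the core in at most one vertex. -/
theorem Reduced.eq_of_mem_cut {e : E} {t u w : V} (ho : owner a b S e = Sum.inr t)
    (hu : ¬ IsSmall a b S u) (hw : ¬ IsSmall a b S w) (heu : e ∈ cut a b {u})
    (hew : e ∈ cut a b {w}) : u = w ∧ e ∈ cut a b {t} := by
  have h1 := owner_eq_inr ho
  rw [mem_cut_singleton] at heu hew ⊢
  grind

variable [Fintype V]

/-- Available elements, distributed among the colours and two further halves for each colour,
connect the classes of `s` in every half. -/
theorem exists_halves (hk : 0 < k) (avail : E ⊕ V → Prop) (s : Setoid (Core a b S v))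
    (h : ∀ r : Setoid (Core a b S v), r ≤ s → ∃ T : Finset (E ⊕ V),
      2 * k * (Nat.card (Quotient r) - Nat.card (Quotient s)) ≤ T.card ∧
      ∀ x ∈ T, ∃ u w : Core a b S v,
        (avail x ∧ Meets a b S v x u ∧ Meets a b S v x w ∧ s u w) ∧ ¬ r u w) :
    ∃ φ : E ⊕ V → Fin k × Bool, ∀ j (Y : Set (Core a b S v)),
      (∀ x, φ x = j → ∀ u w : Core a b S v,
        avail x ∧ Meets a b S v x u ∧ Meets a b S v x w ∧ s u w → (u ∈ Y ↔ w ∈ Y)) →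
      ∀ u w, s u w → (u ∈ Y ↔ w ∈ Y) := by
  have : Nonempty (Fin k × Bool) := ⟨⟨⟨0, hk⟩, true⟩⟩
  have : Fintype (Core a b S v) := Fintype.ofFinite _
  refine exists_connecting_distribution
    (fun x (u w : Core a b S v) => avail x ∧ Meets a b S v x u ∧ Meets a b S v x w ∧ s u w) s
    (fun _ _ _ hN => hN.2.2.2) fun r hr => ?_
  rw [Fintype.card_prod, Fintype.card_fin, Fintype.card_bool, mul_comm k 2]
  exact h r hr

theorem Reduced.exists_coloring_of_forall (h : Reduced Q a b S v D P)
    (hr : ∀ r : Setoid (Core a b S v), Nat.card (Quotient r) = 2 →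
      2 * k ≤ (freeCrossing a b S v r).card) :
    ∃ c, GoodColoring a b S v D P c := by
  classical
  obtain ⟨col, hcol⟩ := h.exists_root_color
  obtain ⟨s₀, hs₀, hs₀v⟩ := h.other
  let u₀ : Core a b S v := ⟨s₀, hs₀v, not_isSmall_of_mem hs₀⟩
  obtain ⟨φ, hφ⟩ := exists_halves (a := a) (b := b) (S := S) (v := v) h.pos
    (fun x => ¬ Rooted a b S v x) ⊤ fun r _ => by
      refine ⟨freeCrossing a b S v r, ?_, fun x hx => ?_⟩
      · have h1 : 1 ≤ Nat.card (Quotient (⊤ : Setoid (Core a b S v))) :=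
          Nat.card_pos_iff.2 ⟨⟨Quotient.mk _ u₀⟩, inferInstance⟩
        refine (Nat.mul_le_mul_left (2 * k) (Nat.sub_le_sub_left h1 _)).trans ?_
        rcases Nat.lt_or_ge (Nat.card (Quotient r)) 3 with h4 | h4
        · rcases Nat.lt_or_ge (Nat.card (Quotient r)) 2 with h5 | h5
          · rw [show Nat.card (Quotient r) - 1 = 0 by omega]
            simp
          · have h6 : Nat.card (Quotient r) = 2 := by omega
            have := hr r h6
            rw [h6]
            omega
        · exact h.two_mul_card_quotient_le r h4
      · obtain ⟨⟨u, w, hu, hw, huw⟩, hR⟩ := mem_freeCrossing.1 hx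
        exact ⟨u, w, ⟨hR, hu, hw, trivial⟩, huw⟩
  refine h.exists_coloring_of_packing (fun x => if Rooted a b S v x then col x else (φ x).1) ∅ ⊤ φ
    (fun x => ¬ Rooted a b S v x) (fun e he => ?_) (fun x hx => ⟨if_neg hx, by simp⟩) (by simp)
    (fun t ht e he _ => ?_) hφ (fun _ _ _ => Or.inl trivial) (fun u => ?_)
  · rw [if_pos ⟨e, rfl, he⟩]
    exact hcol e he
  · obtain ⟨f, hf, hfv⟩ := h.exists_edge_of_isSmall ht he
    exact ⟨f, hf, hfv, by simp⟩
  · by_cases hu : ∀ w, w = u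
    · exact Or.inr (Or.inr hu)
    · push Not at hu
      obtain ⟨w, hw⟩ := hu
      exact Or.inl ⟨w, hw, trivial⟩

open Classical in
/-- Elements joining the two sides of a tight bipartition, one for each colour. -/
theorem Reduced.exists_connectors (h : Reduced Q a b S v D P) {col : E ⊕ V → Fin k}
    (hcol : ∀ e ∈ cut a b {v}, col (owner a b S e) = P e) {r : Setoid (Core a b S v)}
    (hr : Q * k ≤ 2 * (freeCrossing a b S v r).card + (rootedCrossing a b S v r).card) :
    ∃ con : Fin k → E ⊕ V, Function.Injective con ∧ ∀ i, con i ∈ freeCrossing a b S v r ∨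
      con i ∈ rootedCrossing a b S v r ∧ col (con i) = i := by
  let NF : Finset (Fin k) :=
    Finset.univ.filter fun i => ¬ ∃ x ∈ rootedCrossing a b S v r, col x = i
  have hNF : ∀ i, i ∈ NF ↔ ¬ ∃ x ∈ rootedCrossing a b S v r, col x = i := fun i => by simp [NF]
  have h1 : 2 * NF.card ≤
      ((cut a b {v}).filter (¬ owner a b S · ∈ rootedCrossing a b S v r)).card := by
    calc 2 * NF.card = ∑ i ∈ NF, 2 := by simp [mul_comm]
      _ ≤ ∑ i ∈ NF, ((cut a b {v}).filter (P · = i)).card :=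
        Finset.sum_le_sum fun i _ => h.twice i
      _ = (NF.biUnion fun i => (cut a b {v}).filter (P · = i)).card := by
        rw [Finset.card_biUnion]
        intro i _ j _ hij
        rw [Function.onFun, Finset.disjoint_left]
        intro e he he'
        rw [Finset.mem_filter] at he he'
        exact hij (he.2.symm.trans he'.2)
      _ ≤ _ := by
        refine Finset.card_le_card fun e he => ?_
        simp only [Finset.mem_biUnion, Finset.mem_filter] at he ⊢
        obtain ⟨i, hi, he, rfl⟩ := he
        exact ⟨he, fun hY => (hNF _).1 hi ⟨_, hY, hcol e he⟩⟩
  have h2 := card_rootedCrossing_le r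
  have h3 := Finset.card_filter_add_card_filter_not (s := cut a b {v})
    (owner a b S · ∈ rootedCrossing a b S v r)
  have h4 := h.card_cut_v
  have h5 : Fintype.card NF ≤ Fintype.card (freeCrossing a b S v r) := by
    rw [Fintype.card_coe, Fintype.card_coe]
    omega
  obtain ⟨f⟩ := Function.Embedding.nonempty_of_card_le h5
  let con : Fin k → E ⊕ V := fun i =>
    if hi : ∃ x ∈ rootedCrossing a b S v r, col x = i then hi.choose else f ⟨i, (hNF i).2 hi⟩
  have hc1 : ∀ i (hi : ∃ x ∈ rootedCrossing a b S v r, col x = i),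
      con i ∈ rootedCrossing a b S v r ∧ col (con i) = i := fun i hi => by
    simp only [con, dif_pos hi]
    exact hi.choose_spec
  have hc2 : ∀ i (hi : ¬ ∃ x ∈ rootedCrossing a b S v r, col x = i),
      con i = f ⟨i, (hNF i).2 hi⟩ := fun i hi => by simp only [con, dif_neg hi]
  have hc3 : ∀ i, (¬ ∃ x ∈ rootedCrossing a b S v r, col x = i) →
      con i ∈ freeCrossing a b S v r := fun i hi => by
    rw [hc2 i hi]
    exact (f _).2
  have hdis : ∀ x, x ∈ rootedCrossing a b S v r → x ∉ freeCrossing a b S v r := fun x hx hx' =>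
    (mem_freeCrossing.1 hx').2 (mem_rootedCrossing.1 hx).2
  refine ⟨con, fun i j hij => ?_, fun i => ?_⟩
  · by_cases hi : ∃ x ∈ rootedCrossing a b S v r, col x = i <;>
      by_cases hj : ∃ x ∈ rootedCrossing a b S v r, col x = j
    · rw [← (hc1 i hi).2, hij, (hc1 j hj).2]
    · exact absurd (hij ▸ hc3 j hj) (hdis _ (hc1 i hi).1)
    · exact absurd (hij ▸ hc3 i hi) (hdis _ (hc1 j hj).1)
    · rw [hc2 i hi, hc2 j hj] at hij
      exact Subtype.mk.inj (f.injective (Subtype.ext hij))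
  · by_cases hi : ∃ x ∈ rootedCrossing a b S v r, col x = i
    · exact Or.inr (hc1 i hi)
    · exact Or.inl (hc3 i hi)

theorem Reduced.exists_coloring_of_card_lt (h : Reduced Q a b S v D P)
    (r₀ : Setoid (Core a b S v)) (hr₀ : Nat.card (Quotient r₀) = 2)
    (hO : (freeCrossing a b S v r₀).card < 2 * k) :
    ∃ c, GoodColoring a b S v D P c := by
  classical
  obtain ⟨col, hcol⟩ := h.exists_root_color
  have hconn := h.conn_le_of_card_quotient_eq_two r₀ hr₀ hO
  obtain ⟨con, hcon, hconm⟩ := h.exists_connectors hcol hconn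
  have hconc : ∀ i, Crosses a b S v r₀ (con i) := fun i => (hconm i).elim
    (fun hx => (mem_freeCrossing.1 hx).1) fun hx => (mem_rootedCrossing.1 hx.1).1
  -- the two sides
  obtain ⟨side, hside⟩ : ∃ side : Core a b S v → Bool, ∀ u w, r₀ u w ↔ side u = side w := by
    obtain ⟨y, z, hyz, huniv⟩ := Nat.card_eq_two_iff.1 hr₀
    have hmem : ∀ q, q = y ∨ q = z := fun q => by
      have : q ∈ ({y, z} : Set _) := huniv ▸ Set.mem_univ q
      simpa using this
    refine ⟨fun u => decide (Quotient.mk r₀ u = y), fun u w => ?_⟩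
    rw [← Quotient.eq (r := r₀), decide_eq_decide]
    rcases hmem (Quotient.mk r₀ u) with h1 | h1 <;> rcases hmem (Quotient.mk r₀ w) with h2 | h2 <;>
      simp [h1, h2, hyz, hyz.symm]
  have hcross : ∀ x, Crosses a b S v r₀ x → ∀ o, ∃ u : Core a b S v, Meets a b S v x u ∧
      side u = o := by
    rintro x ⟨u, w, hu, hw, huw⟩ o
    rw [hside] at huw
    by_cases h1 : side u = o
    · exact ⟨u, hu, h1⟩
    · exact ⟨w, hw, by revert huw h1; cases side u <;> cases side w <;> cases o <;> simp⟩
  -- rooted elements sacrificed in order to balance a side with only one vertex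
  obtain ⟨Ys, hYs, hYcard, hYdis⟩ : ∃ Ys : Bool → Finset (E ⊕ V),
      (∀ o, ∀ x ∈ Ys o, x ∈ rootedCrossing a b S v r₀ ∧ ∀ i, con i ≠ x) ∧
      (∀ o, (Ys o).card = 2 * k) ∧ ∀ o o', ∀ x ∈ Ys o, x ∈ Ys o' → o = o' := by
    have h1 : 4 * k ≤ (rootedCrossing a b S v r₀ \ Finset.univ.image con).card := by
      have h2 := Finset.le_card_sdiff (Finset.univ.image con) (rootedCrossing a b S v r₀)
      have h3 : (Finset.univ.image con).card ≤ k := by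
        simpa using Finset.card_image_le (s := Finset.univ) (f := con)
      have h4 : 36 * k ≤ Q * k := Nat.mul_le_mul_right _ h.large
      omega
    obtain ⟨Y₁, hY₁, hc₁⟩ := Finset.exists_subset_card_eq
      (show 2 * k ≤ (rootedCrossing a b S v r₀ \ Finset.univ.image con).card by omega)
    have h5 := Finset.le_card_sdiff Y₁ (rootedCrossing a b S v r₀ \ Finset.univ.image con)
    obtain ⟨Y₂, hY₂, hc₂⟩ := Finset.exists_subset_card_eq (show 2 * k ≤
      ((rootedCrossing a b S v r₀ \ Finset.univ.image con) \ Y₁).card by omega)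
    have h6 : ∀ x ∈ rootedCrossing a b S v r₀ \ Finset.univ.image con,
        x ∈ rootedCrossing a b S v r₀ ∧ ∀ i, con i ≠ x := fun x hx => by
      simpa using hx
    refine ⟨fun o => if o then Y₁ else Y₂, ?_, ?_, ?_⟩
    · rintro (_ | _) x hx
      · exact h6 x (Finset.mem_sdiff.1 (hY₂ (by simpa using hx))).1
      · exact h6 x (hY₁ (by simpa using hx))
    · rintro (_ | _) <;> simp [hc₁, hc₂]
    · have h7 : ∀ x ∈ Y₂, x ∉ Y₁ := fun x hx => (Finset.mem_sdiff.1 (hY₂ hx)).2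
      rintro (_ | _) (_ | _) x hx hx'
      · rfl
      · exact absurd (by simpa using hx') (h7 x (by simpa using hx))
      · exact absurd (by simpa using hx) (h7 x (by simpa using hx'))
      · rfl
  let drop : Finset E := Finset.univ.filter fun e => e ∉ cut a b {v} ∧
    ∃ u : Core a b S v, e ∈ cut a b {u.1} ∧ owner a b S e ∈ Ys (side u)
  have hdrop : ∀ e, e ∈ drop ↔ e ∉ cut a b {v} ∧
      ∃ u : Core a b S v, e ∈ cut a b {u.1} ∧ owner a b S e ∈ Ys (side u) := fun e => by
    simp [drop]
  have hdropo : ∀ e ∈ drop, owner a b S e ∈ rootedCrossing a b S v r₀ ∧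
      ∀ i, con i ≠ owner a b S e := fun e he => by
    obtain ⟨-, u, -, hu⟩ := (hdrop e).1 he
    exact hYs _ _ hu
  let avail : E ⊕ V → Prop := fun x => ¬ Rooted a b S v x ∧ ∀ i, con i ≠ x
  obtain ⟨φ, hφ⟩ := exists_halves (a := a) (b := b) (S := S) (v := v) h.pos avail r₀ fun r _ => by
    rcases Nat.lt_or_ge (Nat.card (Quotient r)) 3 with h4 | h4
    · refine ⟨∅, ?_, by simp⟩
      rw [hr₀, show Nat.card (Quotient r) - 2 = 0 by omega]
      simp
    · refine ⟨freeCrossing a b S v r \ freeCrossing a b S v r₀, ?_, fun x hx => ?_⟩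
      · have h1 := h.two_mul_card_quotient_le r h4
        have h3 := Finset.le_card_sdiff (freeCrossing a b S v r₀) (freeCrossing a b S v r)
        obtain ⟨p, hp⟩ := Nat.exists_eq_add_of_le h4
        rw [hp, show 3 + p - 1 = (p + 1) + 1 by omega, mul_add] at h1
        rw [hr₀, hp, show 3 + p - 2 = p + 1 by omega]
        omega
      · rw [Finset.mem_sdiff] at hx
        obtain ⟨⟨u, w, hu, hw, huw⟩, hR⟩ := mem_freeCrossing.1 hx.1
        refine ⟨u, w, ⟨⟨hR, fun i hi => ?_⟩, hu, hw, ?_⟩, huw⟩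
        · exact hx.2 (mem_freeCrossing.2 ⟨hi ▸ hconc i, hR⟩)
        · by_contra h5
          exact hx.2 (mem_freeCrossing.2 ⟨⟨u, w, hu, hw, h5⟩, hR⟩)
  let colI : E ⊕ V → Fin k := fun x =>
    if Rooted a b S v x then col x else if hx : ∃ i, con i = x then hx.choose else (φ x).1
  have hcolcon : ∀ i, colI (con i) = i := by
    intro i
    by_cases hR : Rooted a b S v (con i)
    · simp only [colI, if_pos hR]
      exact ((hconm i).resolve_left fun hx => (mem_freeCrossing.1 hx).2 hR).2
    · have hx : ∃ j, con j = con i := ⟨i, rfl⟩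
      simp only [colI, if_neg hR, dif_pos hx]
      exact hcon hx.choose_spec
  refine h.exists_coloring_of_packing colI drop r₀ φ avail (fun e he => ?_) (fun x hx => ⟨?_, ?_⟩)
    (fun e he => ((hdrop e).1 he).1) (fun t ht e he hev => ?_) hφ (fun i u w => ?_) (fun u => ?_)
  · simp only [colI]
    rw [if_pos ⟨e, rfl, he⟩]
    exact hcol e he
  · have hn : ¬ ∃ i, con i = x := fun ⟨i, hi⟩ => hx.2 i hi
    simp only [colI, if_neg hx.1, dif_neg hn]
  · rintro e rfl he
    exact hx.1 (mem_rootedCrossing.1 (hdropo e he).1).2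
  · by_cases hY : ∃ o, Sum.inr t ∈ Ys o
    · obtain ⟨o, ho⟩ := hY
      obtain ⟨u, ⟨f, hf, hfu, hfv⟩, hu⟩ :=
        hcross _ (mem_rootedCrossing.1 (hYs o _ ho).1).1 (!o)
      refine ⟨f, (Reduced.eq_of_mem_cut hf u.2.2 u.2.2 hfu hfu).2, hfv, fun hfd => ?_⟩
      obtain ⟨-, w, hw, hwY⟩ := (hdrop f).1 hfd
      have h1 := (Reduced.eq_of_mem_cut hf u.2.2 w.2.2 hfu hw).1
      rw [hf, ← Subtype.ext h1, hu] at hwY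
      have := hYdis _ _ _ ho hwY
      simp at this
    · obtain ⟨f, hf, hfv⟩ := h.exists_edge_of_isSmall ht he
      refine ⟨f, hf, hfv, fun hfd => hY ?_⟩
      obtain ⟨-, w, -, hw⟩ := (hdrop f).1 hfd
      rw [h.owner_of_mem_cut ht hf] at hw
      exact ⟨_, hw⟩
  · by_cases huw : r₀ u w
    · exact Or.inl huw
    · obtain ⟨u', ⟨e, he, heu, hev⟩, hu'⟩ := hcross _ (hconc i) (side u)
      obtain ⟨w', ⟨f, hf, hfw, hfv⟩, hw'⟩ := hcross _ (hconc i) (side w)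
      refine Or.inr ⟨e, f, u', w', he.trans hf.symm, by rw [he, hcolcon], ⟨hev, ?_, heu⟩,
        ⟨hfv, ?_, hfw⟩, (hside _ _).2 hu'.symm, (hside _ _).2 hw'⟩
      · exact fun hd => (hdropo e hd).2 i he.symm
      · exact fun hd => (hdropo f hd).2 i hf.symm
  · by_cases hu : ∃ w, w ≠ u ∧ r₀ u w
    · exact Or.inl hu
    · right; left
      push Not at hu
      refine ⟨drop.filter (· ∈ cut a b {u.1}), Finset.filter_subset _ _,
        fun e he => (Finset.mem_filter.1 he).2, ?_⟩
      rw [← hYcard (side u)]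
      refine (Finset.card_le_card ?_).trans (Finset.card_image_le (f := owner a b S))
      intro x hx
      obtain ⟨w, ⟨e, he, hew, hev⟩, hw⟩ :=
        hcross x (mem_rootedCrossing.1 (hYs _ x hx).1).1 (side u)
      have hwu : w = u := by
        by_contra hne
        exact hu w hne ((hside _ _).2 hw.symm)
      subst hwu
      refine Finset.mem_image.2 ⟨e, Finset.mem_filter.2 ⟨(hdrop e).2 ⟨hev, w, hew, ?_⟩, hew⟩, he⟩
      rwa [he]

theorem Reduced.exists_coloring (h : Reduced Q a b S v D P) :
    ∃ c, GoodColoring a b S v D P c := by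
  by_cases hr : ∀ r : Setoid (Core a b S v), Nat.card (Quotient r) = 2 →
      2 * k ≤ (freeCrossing a b S v r).card
  · exact h.exists_coloring_of_forall hr
  · push Not at hr
    obtain ⟨r, hr, hO⟩ := hr
    exact h.exists_coloring_of_card_lt r hr hO

end Packing

section Induction

variable [Fintype E] {a b : E → V} {S : Set V} {v : V} {k Q : ℕ}
  {D : V → ℕ} {P : E → Fin k}

/-- A tight separating set spanning no edges has only one vertex of positive degree, and this
vertex is in `S`. -/
theorem ExtData.mem_of_tight (h : ExtData Q a b S v D P) {X : Set V} (hX : Separates S X)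
    (ht : (cut a b X).card = Q * k) (hin : ∀ e, a e ≠ b e → a e ∈ X → b e ∉ X) {e : E}
    (he : e ∈ cut a b X) : a e ∈ S ∨ b e ∈ S := by
  obtain ⟨⟨s, hs, hsX⟩, s', hs', hsX'⟩ := hX
  have hsep : Separates S {s} :=
    ⟨⟨s, hs, rfl⟩, s', hs', fun h' => hsX' (Set.mem_singleton_iff.1 h' ▸ hsX)⟩
  have hsub : cut a b {s} ⊆ cut a b X := fun f hf => by
    rw [mem_cut_singleton] at hf
    rw [mem_cut]
    have := hin f
    grind
  rw [← Finset.eq_of_subset_of_card_le hsub (ht.trans_le (h.conn _ hsep)),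
    mem_cut_singleton] at he
  grind

/-- The Extension Theorem in terms of cuts. -/
theorem extendable [Fintype V] (hQ : 36 ≤ Q) (hk : 0 < k) (a b : E → V) : Extendable Q k a b := by
  classical
  induction hn : (nonloop a b).card using Nat.strong_induction_on generalizing a b with
  | _ n ih =>
  subst hn
  replace ih : ∀ a' b' : E → V, (nonloop a' b').card < (nonloop a b).card → Extendable Q k a' b' :=
    fun a' b' h => ih _ h a' b' rfl
  intro S v D P h
  by_cases htight : ∃ X, Separates S X ∧ (cut a b X).card = Q * k ∧
      (∃ e, a e ≠ b e ∧ a e ∈ X ∧ b e ∈ X) ∧ ∃ e, a e ≠ b e ∧ a e ∉ X ∧ b e ∉ X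
  · obtain ⟨X, hX, ht, he, he'⟩ := htight
    refine h.exists_coloring_of_tight hk X hX ht (fun f ⟨e, hne, hf⟩ => ih _ _ ?_) he he'
    refine Finset.card_lt_card ((Finset.ssubset_iff_of_subset fun e' he' => ?_).2
      ⟨e, mem_nonloop.2 hne, fun h' => mem_nonloop.1 h' hf⟩)
    exact mem_nonloop.2 fun h' => mem_nonloop.1 he' (congrArg f h')
  by_cases hdel : ∃ e, a e ≠ b e ∧ ∀ X, Separates S X → (cut a b X).card = Q * k → e ∉ cut a b X
  · obtain ⟨e, hne, he⟩ := hdel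
    refine h.exists_coloring_of_delete e he ?_
    convert ih a (Function.update b e (a e)) ?_
    refine Finset.card_lt_card ((Finset.ssubset_iff_of_subset fun e' he' => ?_).2
      ⟨e, mem_nonloop.2 hne, fun h' => mem_nonloop.1 h' (by simp)⟩)
    rw [mem_nonloop] at he' ⊢
    by_cases h' : e' = e
    · rwa [h']
    · rwa [Function.update_of_ne h'] at he'
  push Not at htight hdel
  have hmeets : ∀ e, a e ≠ b e → a e ∈ S ∨ b e ∈ S := by
    intro e hne
    obtain ⟨X, hX, ht, he⟩ := hdel e hne
    by_cases hin : ∃ e, a e ≠ b e ∧ a e ∈ X ∧ b e ∈ X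
    · have := htight X hX ht hin
      refine h.mem_of_tight hX.compl (by rw [cut_compl, ht]) (fun f hf hfa hfb => ?_)
        (by rwa [cut_compl])
      exact hfb (this f hf hfa)
    · push Not at hin
      exact h.mem_of_tight hX ht hin he
  have h36 : 36 * 1 ≤ Q * k := Nat.mul_le_mul hQ hk
  by_cases hsplit : ∃ t, t ∉ S ∧ (cut a b {t}).card + 2 * k ≤ D t ∧ 4 ≤ (cut a b {t}).card
  · obtain ⟨t, ht, hD, hd⟩ := hsplit
    refine h.exists_coloring_of_split ht (fun e he => ?_) (by omega) hD hd ih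
    have h1 := mem_cut_singleton.1 he
    have h2 := hmeets e (by rintro h'; simp [h'] at h1)
    have h3 := otherEnd_cases he
    grind
  push Not at hsplit
  refine Reduced.exists_coloring
    { h with large := hQ, pos := hk, meets := hmeets, outside := fun t ht => ?_ }
  by_cases hD : (cut a b {t}).card + 2 * k ≤ D t
  · exact Or.inl ⟨Nat.lt_succ_iff.1 (hsplit t ht hD), hD⟩
  · right
    have h1 := (h.D_large t).resolve_left hD
    have h2 : (Q - 2) * k = (Q - 4) * k + 2 * k := by rw [← add_mul]; congr 1; omega
    omega

end Induction

section Paths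

variable {ends : E → Sym2 V} {F : Set E}

theorem Reaches.symm {x y : V} (h : Reaches ends F x y) : Reaches ends F y x := by
  induction h with
  | refl => exact Relation.ReflTransGen.refl
  | tail _ h ih =>
    obtain ⟨e, he, hxy⟩ := h
    exact Relation.ReflTransGen.head ⟨e, he, hxy.trans Sym2.eq_swap⟩ ih

theorem Reaches.mono {F' : Set E} (hF : F ⊆ F') {x y : V} (h : Reaches ends F x y) :
    Reaches ends F' x y :=
  Relation.ReflTransGen.mono (fun _ _ ⟨e, he, hxy⟩ => ⟨e, hF he, hxy⟩) _ _ h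

variable {a b : E → V}

theorem mem_incEdges (hab : ∀ e, ends e = s(a e, b e)) {u : V} {e : E} :
    e ∈ incEdges ends u ↔ u = a e ∨ u = b e := by
  rw [incEdges, Set.mem_ofPred_eq, hab, Sym2.mem_iff]

variable {k : ℕ} {S : Set V} {v : V} {D : V → ℕ} {P : E → Fin k} {c : E → Option (Fin k)}
  {i : Fin k}

/-- The edges of a given colour, without loops. -/
def colorClass (a b : E → V) (c : E → Option (Fin k)) (i : Fin k) : Set E :=
  {e | a e ≠ b e ∧ c e = some i}

theorem terminal_of_step (hab : ∀ e, ends e = s(a e, b e)) {x : V}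
    (h : Step ends (colorClass a b c i) v x) : Terminal a b S v c i x := by
  obtain ⟨e, he, hx⟩ := h
  rw [hab, Sym2.eq_iff] at hx
  refine ⟨?_, Or.inr ⟨e, he.2, by tauto⟩⟩
  rintro rfl
  have := he.1
  grind

variable [Fintype E]

theorem IsWalk.exists_mem_cut (hab : ∀ e, ends e = s(a e, b e)) {X : Set V} {x y : V} {l : List E}
    (h : IsWalk ends x y l) (hx : x ∈ X) (hy : y ∉ X) : ∃ e ∈ l, e ∈ cut a b X := by
  induction h with
  | nil => exact absurd hx hy
  | @cons u w z e l he _ ih =>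
    by_cases hw : w ∈ X
    · obtain ⟨f, hf, hfX⟩ := ih hw hy
      exact ⟨f, List.mem_cons_of_mem _ hf, hfX⟩
    · refine ⟨e, List.mem_cons_self, ?_⟩
      rw [hab, Sym2.eq_iff] at he
      rw [mem_cut]
      grind

theorem EdgeConnectedIn.le_card_cut (hab : ∀ e, ends e = s(a e, b e)) {S X : Set V} {n : ℕ}
    (h : EdgeConnectedIn ends Set.univ S n) (hX : Separates S X) : n ≤ (cut a b X).card := by
  obtain ⟨⟨s, hs, hsX⟩, t, ht, htX⟩ := hX
  obtain ⟨p, hp, hdis⟩ := h s hs t ht (fun h' => htX (h' ▸ hsX))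
  choose f hf hfX using fun i => (hp i).1.exists_mem_cut hab hsX htX
  have hinj : Function.Injective f := fun i j hij => by
    by_contra hne
    exact hdis i j hne _ (hf i) (hij ▸ hf j)
  simpa using Finset.card_le_card_of_injOn (s := Finset.univ) f (fun i _ => hfX i) hinj.injOn

theorem coe_cut_subset_incEdges (hab : ∀ e, ends e = s(a e, b e)) (u : V) :
    (cut a b {u} : Set E) ⊆ incEdges ends u := fun e he => by
  rw [Finset.mem_coe, mem_cut_singleton] at he
  rw [mem_incEdges hab]
  grind

theorem card_cut_le_deg (hab : ∀ e, ends e = s(a e, b e)) (u : V) :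
    (cut a b {u}).card ≤ deg ends u := by
  rw [← Set.ncard_coe_finset]
  exact Set.ncard_le_ncard (coe_cut_subset_incEdges hab u) (Set.toFinite _)

theorem GoodColoring.reaches_of_terminal (hc : GoodColoring a b S v D P c)
    (hab : ∀ e, ends e = s(a e, b e)) {x y : V} (hx : Terminal a b S v c i x)
    (hy : Terminal a b S v c i y) :
    Reaches ends {e ∈ colorClass a b c i | v ∉ ends e} x y := by
  let Y : Set V := {z | Reaches ends {e ∈ colorClass a b c i | v ∉ ends e} x z}
  have hvY : v ∉ Y := fun hv => by
    rcases Relation.ReflTransGen.cases_tail hv with h1 | ⟨z, -, e, he, hez⟩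
    · exact hx.1 h1.symm
    · exact he.2 (hez ▸ Sym2.mem_mk_right _ _)
  have hY : ∀ e, c e = some i → e ∉ cut a b {v} → e ∉ cut a b Y := fun e he hev heY => by
    rw [mem_cut] at heY
    rw [mem_cut_singleton] at hev
    have hne : a e ≠ b e := fun h' => heY (by rw [h'])
    have hmem : e ∈ {e ∈ colorClass a b c i | v ∉ ends e} := by
      refine ⟨⟨hne, he⟩, ?_⟩
      rw [hab, Sym2.mem_iff]
      grind
    exact heY ⟨fun h' => Relation.ReflTransGen.tail h' ⟨e, hmem, hab e⟩,
      fun h' => Relation.ReflTransGen.tail h' ⟨e, hmem, (hab e).trans Sym2.eq_swap⟩⟩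
  rcases hc.conn i Y hvY hY with h1 | h1
  · exact h1 y hy
  · exact absurd Relation.ReflTransGen.refl (h1 x hx)

theorem GoodColoring.not_isCutVertexOf (hc : GoodColoring a b S v D P c)
    (hab : ∀ e, ends e = s(a e, b e)) : ¬ IsCutVertexOf ends (colorClass a b c i) v := by
  rintro ⟨x, y, hx, hy, hxy, hn⟩
  have key : (y ≠ v → Reaches ends {e ∈ colorClass a b c i | v ∉ ends e} x y) ∧
      (y = v → ∃ z, Terminal a b S v c i z ∧
        Reaches ends {e ∈ colorClass a b c i | v ∉ ends e} x z) := by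
    clear hy hn
    induction hxy with
    | refl => exact ⟨fun _ => Relation.ReflTransGen.refl, fun h => absurd h hx⟩
    | @tail y z _ hyz ih =>
      by_cases hyv : y = v
      · subst hyv
        obtain ⟨w, hw, hxw⟩ := ih.2 rfl
        have hz := terminal_of_step (S := S) hab hyz
        exact ⟨fun _ => hxw.trans (hc.reaches_of_terminal hab hw hz), fun h => absurd h hz.1⟩
      · obtain ⟨e, he, hyz⟩ := hyz
        refine ⟨fun hz => (ih.1 hyv).tail ⟨e, ⟨he, ?_⟩, hyz⟩, ?_⟩
        · rw [hyz, Sym2.mem_iff]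
          grind
        · rintro rfl
          exact ⟨y, terminal_of_step hab ⟨e, he, hyz.trans Sym2.eq_swap⟩, ih.1 hyv⟩
  exact hn (key.1 hy)

theorem GoodColoring.connectsSet (hc : GoodColoring a b S v D P c)
    (hab : ∀ e, ends e = s(a e, b e)) (hP : ∃ e ∈ cut a b {v}, P e = i) :
    ConnectsSet ends (colorClass a b c i) S := by
  obtain ⟨e, he, rfl⟩ := hP
  have hce := hc.ext e he
  rw [mem_cut_singleton] at he
  have hmem : e ∈ colorClass a b c (P e) := ⟨fun h' => he (by rw [h']), hce⟩
  obtain ⟨z, hz⟩ : ∃ z, ends e = s(v, z) := by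
    rw [← Sym2.mem_iff_exists, hab, Sym2.mem_iff]
    grind
  have hvz : Step ends (colorClass a b c (P e)) v z := ⟨e, hmem, hz⟩
  have hv : ∀ x ∈ S, Reaches ends (colorClass a b c (P e)) v x := by
    intro x hx
    by_cases hxv : x = v
    · subst hxv
      exact Relation.ReflTransGen.refl
    · exact Relation.ReflTransGen.head hvz ((hc.reaches_of_terminal hab (terminal_of_step hab hvz)
        ⟨hxv, Or.inl hx⟩).mono (Set.sep_subset _ _))
  exact fun x hx y hy => (hv x hx).symm.trans (hv y hy)

theorem GoodColoring.balanceVertex (hk : 0 < k) (hc : GoodColoring a b S v D P c)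
    (hab : ∀ e, ends e = s(a e, b e)) {u : V} (hu : D u = deg ends u) :
    BalanceVertex ends (colorClass a b c) u := by
  classical
  let A : Finset E := (incEdges ends u).toFinset
  let c' : E → Option (Fin k) := fun e => if a e = b e then none else c e
  have hA : A.card = D u := by rw [hu, deg, Set.ncard_eq_toFinset_card']
  have hAc : ∀ i, A.filter (c' · = some i) = (cut a b {u}).filter (c · = some i) := by
    intro i
    ext e
    simp only [A, c', Finset.mem_filter, Set.mem_toFinset, mem_incEdges hab, mem_cut_singleton]
    grind
  obtain ⟨q, hq, hq2⟩ := exists_balanced_completion hk A c' (by simpa only [hAc, hA] using hc.bal u)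
  refine ⟨⟨fun i => Set.inter_subset_left, fun i j hij => ?_⟩,
    fun i => {e | e ∈ incEdges ends u ∧ q e = i}, ⟨⟨fun i e he => he.1, fun i j hij => ?_⟩, ?_,
      fun i => ?_⟩, fun i e he => ⟨he.1, ?_⟩⟩
  · rw [Set.disjoint_left]
    exact fun e he he' => hij (Option.some.inj (he.2.2.symm.trans he'.2.2))
  · rw [Set.disjoint_left]
    exact fun e he he' => hij (he.2.symm.trans he'.2)
  · ext e
    simp
  · refine (hq2 i).trans_eq ?_
    rw [← Set.ncard_coe_finset]
    congr 1
    ext e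
    simp [A]
  · exact hq e (by simpa [A] using he.1) i (by simp [c', he.2.1, he.2.2])

end Paths

/-- The Extension Theorem. -/
theorem not_extCex {V E : Type} [Fintype V] [Fintype E] {Q k : ℕ} {ends : E → Sym2 V}
    {S R : Set V} {v : V} {P : Fin k → Set E} : ¬ ExtCex Q k ends S R v P := by
  classical
  rintro ⟨hQ, hk, -, hS, hconn, hR, hv, hloop, hdeg,
    ⟨-, P', ⟨⟨hP'inc, hP'dis⟩, hP'cov, hP'2⟩, hPP'⟩, -, hno⟩
  have hab : ∀ e, ∃ x y, ends e = s(x, y) := fun e =>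
    (ends e).ind (f := fun z => ∃ x y, z = s(x, y)) fun x y => ⟨x, y, rfl⟩
  choose a b hab using hab
  have hcutv : (cut a b {v} : Set E) = incEdges ends v := by
    refine (coe_cut_subset_incEdges hab v).antisymm fun e he => ?_
    have h1 := hloop e he
    rw [hab, Sym2.mk_isDiag_iff] at h1
    rw [mem_incEdges hab] at he
    rw [Finset.mem_coe, mem_cut_singleton]
    grind
  have hpart : ∀ e, e ∈ cut a b {v} → ∃ i, e ∈ P' i := fun e he => by
    rw [← Finset.mem_coe, hcutv, ← hP'cov] at he
    exact Set.mem_iUnion.1 he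
  let p : E → Fin k := fun e => if h : ∃ i, e ∈ P' i then h.choose else ⟨0, hk⟩
  have hp : ∀ e i, e ∈ P' i → p e = i := fun e i he => by
    have h : ∃ i, e ∈ P' i := ⟨i, he⟩
    simp only [p, dif_pos h]
    by_contra hne
    exact Set.disjoint_left.1 (hP'dis _ _ hne) h.choose_spec he
  have htwice : ∀ i, 2 ≤ ((cut a b {v}).filter (p · = i)).card := fun i => by
    refine (hP'2 i).trans ?_
    rw [← Set.ncard_coe_finset]
    refine Set.ncard_le_ncard (fun e he => ?_) (Set.toFinite _)
    rw [Finset.mem_coe, Finset.mem_filter, ← Finset.mem_coe, hcutv]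
    exact ⟨hP'inc i he, hp e i he⟩
  obtain ⟨s₁, hs₁, s₂, hs₂, hne⟩ := (Set.one_lt_ncard (Set.toFinite S)).1 hS
  have hsing : ∀ u ∈ S, Separates S {u} := fun u hu => by
    refine ⟨⟨u, hu, rfl⟩, ?_⟩
    by_cases h : s₁ = u
    · exact ⟨s₂, hs₂, fun h' => hne (h.trans h'.symm)⟩
    · exact ⟨s₁, hs₁, h⟩
  let D : V → ℕ := fun u => if u ∈ S ∪ R then deg ends u else (cut a b {u}).card + 2 * k
  have hD : ∀ u ∈ S ∪ R, D u = deg ends u := fun u hu => if_pos hu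
  have hD' : ∀ u, u ∉ S ∪ R → D u = (cut a b {u}).card + 2 * k := fun u hu => if_neg hu
  obtain ⟨c, hc⟩ := extendable hQ hk a b S v D p
    { mem := hv
      other := by
        obtain ⟨s, hs, hsv⟩ := (hsing v hv).2
        exact ⟨s, hs, hsv⟩
      conn := fun X hX => hconn.le_card_cut hab hX
      card_cut_v := by rw [← hdeg, deg, ← hcutv, Set.ncard_coe_finset]
      le_D := fun u => by
        by_cases hu : u ∈ S ∪ R
        · exact (card_cut_le_deg hab u).trans_eq (hD u hu).symm
        · rw [hD' u hu]
          exact Nat.le_add_right _ _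
      D_large := fun u => by
        by_cases hu : u ∈ S ∪ R
        · right
          rw [hD u hu]
          rcases hu with hu | hu
          · exact (Nat.mul_le_mul_right k (Nat.sub_le Q 2)).trans
              ((hconn.le_card_cut hab (hsing u hu)).trans (card_cut_le_deg hab u))
          · exact hR u hu
        · exact Or.inl (hD' u hu).ge
      twice := htwice }
  refine hno ⟨colorClass a b c, fun i j hij => ?_, fun i => ?_,
    fun u hu => hc.balanceVertex hk hab (hD u hu), fun i =>
      ⟨fun e he => ?_, hc.not_isCutVertexOf hab⟩⟩
  · rw [Set.disjoint_left]
    exact fun e he he' => hij (Option.some.inj (he.2.symm.trans he'.2))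
  · obtain ⟨e, he⟩ := Finset.card_pos.1 (Nat.zero_lt_two.trans_le (htwice i))
    rw [Finset.mem_filter] at he
    exact hc.connectsSet hab ⟨e, he⟩
  · have h1 : e ∈ cut a b {v} := by
      rw [← Finset.mem_coe, hcutv]
      exact hP'inc i (hPP' i he)
    refine ⟨fun h' => ?_, by rw [hc.ext e h1, hp e i (hPP' i he)]⟩
    rw [mem_cut_singleton, h'] at h1
    exact h1 Iff.rfl

/-- In a minimal counterexample to the Extension Theorem,
`V(G) − S − R` is an independent set: every edge has an endpoint in
`S ∪ R`. -/
theorem min_cex_independent {V E : Type} [Fintype V] [Fintype E]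
    (Q k : ℕ) (ends : E → Sym2 V) (S R : Set V) (v : V) (P : Fin k → Set E)
    (h : MinExtCex Q k ends S R v P) :
    ∀ e : E, ∃ x ∈ ends e, x ∈ S ∪ R :=
  absurd h.1 not_extCex

end SteinerPacking
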